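/- Let M^{4n+3} be a 3-quasi-Sasakian manifold of rank 4l+3. Then for each β, γ ∈ {1,2,3}, the pair (η_β, Θ_γ) — where Θ_γ is the closed 2-form obtained by restricting Φ_γ to the distribution E^{4m} (extended by zero on E^{4l+3}) — is a contact-symplectic pair of type (2l+1, 2m). -/

import Mathlib

/-!
An abstract (Lie–Rinehart style) algebraic model of the differential geometry of
almost contact metric 3-structures: `F` plays the role of the algebra of smooth
functions on a manifold `M` of dimension `4n+3`, and `V` plays the role of the
`F`-module of smooth vector fields, acting on `F` by derivations and carrying a
Lie bracket, a Riemannian metric `g`, and three almost contact metric structures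
`(φ_α, ξ_α, η_α, g)`.
-/

noncomputable section

namespace QS3

/-- Cyclic (= even) permutations of `{0,1,2}`, modelling even permutations of `{1,2,3}`. -/
def Cyclic (a b c : Fin 3) : Prop :=
  (a, b, c) = (0, 1, 2) ∨ (a, b, c) = (1, 2, 0) ∨ (a, b, c) = (2, 0, 1)

/-- The algebraic model of the smooth structure of a manifold: an `ℝ`-algebra `F`
of smooth functions and an `F`-module `V` of vector fields acting on `F` by
derivations and carrying the Lie bracket of vector fields. -/
class SmoothSetting (F : Type) (V : Type) [CommRing F] [Algebra ℝ F]
    [AddCommGroup V] [Module F V] where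
  act : V → F → F
  bracket : V → V → V
  act_add : ∀ (X : V) (f₁ f₂ : F), act X (f₁ + f₂) = act X f₁ + act X f₂
  act_mul : ∀ (X : V) (f₁ f₂ : F), act X (f₁ * f₂) = act X f₁ * f₂ + f₁ * act X f₂
  act_const : ∀ (X : V) (r : ℝ), act X (algebraMap ℝ F r) = 0
  act_addLeft : ∀ (X Y : V) (f : F), act (X + Y) f = act X f + act Y f
  act_smulLeft : ∀ (f : F) (X : V) (h : F), act (f • X) h = f * act X h
  bracket_antisymm : ∀ X Y : V, bracket X Y = -bracket Y X
  bracket_addLeft : ∀ X Y Z : V, bracket (X + Y) Z = bracket X Z + bracket Y Z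
  bracket_act : ∀ (X Y : V) (f : F),
    act (bracket X Y) f = act X (act Y f) - act Y (act X f)
  bracket_smulRight : ∀ (X : V) (f : F) (Y : V),
    bracket X (f • Y) = f • bracket X Y + act X f • Y
  jacobi : ∀ X Y Z : V,
    bracket X (bracket Y Z) + bracket Y (bracket Z X) + bracket Z (bracket X Y) = 0

section d

variable (F V : Type) [CommRing F] [Algebra ℝ F] [AddCommGroup V] [Module F V]
  [SmoothSetting F V]

/-- The action of a vector field on a function (directional derivative). -/
def der (X : V) (f : F) : F := SmoothSetting.act X f

/-- The Lie bracket of vector fields. -/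
def lie (X Y : V) : V := SmoothSetting.bracket F X Y

/-- Exterior differential of a 1-form (with the `1/2` normalization convention,
so that `2 dθ(X,Y) = X θ(Y) - Y θ(X) - θ([X,Y])`). -/
def dOne (θ : V → F) (X Y : V) : F :=
  (2 : ℝ)⁻¹ • (der F V X (θ Y) - der F V Y (θ X) - θ (lie F V X Y))

/-- Exterior differential of a 2-form (with the `1/3` normalization convention). -/
def dTwo (ω : V → V → F) (X Y Z : V) : F :=
  (3 : ℝ)⁻¹ • (der F V X (ω Y Z) + der F V Y (ω Z X) + der F V Z (ω X Y)
    - ω (lie F V X Y) Z - ω (lie F V Y Z) X - ω (lie F V Z X) Y)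

end d

/-- An almost contact metric 3-structure on a manifold of dimension `4n+3`:
three almost contact metric structures `(φ_α, ξ_α, η_α, g)` satisfying the
quaternionic-type relations, together with a (local) orthonormal frame. -/
class ACM3 (F V : Type) [CommRing F] [Algebra ℝ F] [AddCommGroup V] [Module F V]
    [SmoothSetting F V] where
  n : ℕ
  g : V → V → F
  phi : Fin 3 → V → V
  xi : Fin 3 → V
  eta : Fin 3 → V → F
  g_symm : ∀ X Y, g X Y = g Y X
  g_addLeft : ∀ X Y Z, g (X + Y) Z = g X Z + g Y Z
  g_smulLeft : ∀ (f : F) (X Y : V), g (f • X) Y = f * g X Y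
  g_nondeg : ∀ X, (∀ Y, g X Y = 0) → X = 0
  phi_add : ∀ α (X Y : V), phi α (X + Y) = phi α X + phi α Y
  phi_smul : ∀ α (f : F) (X : V), phi α (f • X) = f • phi α X
  eta_eq : ∀ α X, eta α X = g X (xi α)
  acm_sq : ∀ α X, phi α (phi α X) = -X + eta α X • xi α
  eta_xi : ∀ α, eta α (xi α) = 1
  compat : ∀ α X Y, g (phi α X) (phi α Y) = g X Y - eta α X * eta α Y
  quat_phi : ∀ a b c, Cyclic a b c → ∀ X, phi c X = phi a (phi b X) - eta b X • xi a
  quat_phi' : ∀ a b c, Cyclic a b c → ∀ X, phi c X = -(phi b (phi a X)) + eta a X • xi b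
  quat_xi : ∀ a b c, Cyclic a b c → xi c = phi a (xi b)
  quat_xi' : ∀ a b c, Cyclic a b c → xi c = -(phi b (xi a))
  quat_eta : ∀ a b c, Cyclic a b c → ∀ X, eta c X = eta a (phi b X)
  quat_eta' : ∀ a b c, Cyclic a b c → ∀ X, eta c X = -(eta b (phi a X))
  frame : Fin (4 * n + 3) → V
  frame_orth : ∀ i j, g (frame i) (frame j) = if i = j then 1 else 0
  frame_span : ∀ X : V, X = ∑ i, g X (frame i) • frame i

section acm

variable (F V : Type) [CommRing F] [Algebra ℝ F] [AddCommGroup V] [Module F V]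
  [SmoothSetting F V] [ACM3 F V]

/-- The integer `n` (the manifold has dimension `4n+3`). -/
def dimn : ℕ := ACM3.n F V

/-- The Riemannian metric. -/
def gm (X Y : V) : F := ACM3.g X Y

/-- The structure tensors `φ_α`. -/
def ph (α : Fin 3) (X : V) : V := ACM3.phi F α X

/-- The Reeb vector fields `ξ_α`. -/
def rxi (α : Fin 3) : V := ACM3.xi F α

/-- The 1-forms `η_α`. -/
def et (α : Fin 3) (X : V) : F := ACM3.eta α X

/-- The orthonormal frame. -/
def fr (i : Fin (4 * dimn F V + 3)) : V := ACM3.frame i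

/-- The fundamental 2-form `Φ_α(X,Y) = g(X, φ_α Y)`. -/
def Phi (α : Fin 3) (X Y : V) : F := gm F V X (ph F V α Y)

/-- The Nijenhuis torsion `[φ_α, φ_α]` of `φ_α`. -/
def Nij (α : Fin 3) (X Y : V) : V :=
  ph F V α (ph F V α (lie F V X Y)) + lie F V (ph F V α X) (ph F V α Y)
    - ph F V α (lie F V (ph F V α X) Y) - ph F V α (lie F V X (ph F V α Y))

/-- The normality tensor `N⁽¹⁾_α = [φ_α, φ_α] + 2 dη_α ⊗ ξ_α`. -/
def NOne (α : Fin 3) (X Y : V) : V :=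
  Nij F V α X Y + ((2 : ℝ) • dOne F V (et F V α) X Y) • rxi F V α

/-- The structure `(φ_α, ξ_α, η_α)` is normal. -/
def IsNormal (α : Fin 3) : Prop := ∀ X Y, NOne F V α X Y = 0

/-- A 2-form is closed. -/
def IsClosedTwo (ω : V → V → F) : Prop := ∀ X Y Z, dTwo F V ω X Y Z = 0

/-- The structure `(φ_α, ξ_α, η_α, g)` is quasi-Sasakian: normal with closed
fundamental 2-form. -/
def IsQuasiSasakian (α : Fin 3) : Prop :=
  IsNormal F V α ∧ IsClosedTwo F V (Phi F V α)

/-- `M` is 3-cosymplectic: each structure is normal with `dη_α = 0` and `dΦ_α = 0`. -/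
def ThreeCosymplectic : Prop :=
  ∀ α, IsNormal F V α ∧ (∀ X Y, dOne F V (et F V α) X Y = 0) ∧
    IsClosedTwo F V (Phi F V α)

/-- `M` is 3-α-Sasakian with constant `a ≠ 0`: each structure is normal (an
`α`-Sasakian structure) and `dη_δ = a Φ_δ`. -/
def Is3AlphaSasakianWith (a : ℝ) : Prop :=
  a ≠ 0 ∧ (∀ δ, IsNormal F V δ) ∧
    ∀ (δ : Fin 3) (X Y : V), dOne F V (et F V δ) X Y = algebraMap ℝ F a * Phi F V δ X Y

/-- A vector field is horizontal: it lies in `H = ∩_α ker η_α`. -/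
def Horiz (X : V) : Prop := ∀ α, et F V α X = 0

/-- A vector field is vertical: it lies in `V = ⟨ξ₁, ξ₂, ξ₃⟩`. -/
def InVert (X : V) : Prop :=
  ∃ p q r : F, X = p • rxi F V 0 + q • rxi F V 1 + r • rxi F V 2

/-- The distribution `E^{4m} = {X ∈ H : i_X dη_α = 0}`. -/
def InE4m (X : V) : Prop :=
  Horiz F V X ∧ ∀ (α : Fin 3) (Y : V), dOne F V (et F V α) X Y = 0

/-- The distribution `E^{4l}`: the orthogonal complement of `E^{4m}` in `H`. -/
def InE4l (X : V) : Prop :=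
  Horiz F V X ∧ ∀ Y, InE4m F V Y → gm F V X Y = 0

/-- The distribution `E^{4l+3} = E^{4l} ⊕ V`. -/
def InE4l3 (X : V) : Prop :=
  ∃ Y Z, InE4l F V Y ∧ InVert F V Z ∧ X = Y + Z

/-- The distribution `E^{4m+3} = E^{4m} ⊕ V`. -/
def InE4m3 (X : V) : Prop :=
  ∃ Y Z, InE4m F V Y ∧ InVert F V Z ∧ X = Y + Z

/-- The horizontal component `X_H = X - ∑_α η_α(X) ξ_α` of a vector field. -/
def horComp (X : V) : V := X - ∑ α : Fin 3, et F V α X • rxi F V α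

/-- A vector field is basic with respect to the foliation defined by `E^{4m}`. -/
def BasicE4m (X : V) : Prop :=
  InE4l3 F V X ∧ ∀ W, InE4m F V W → InE4m F V (lie F V W X)

/-- A vector field is basic with respect to the foliation defined by `E^{4l+3}`. -/
def BasicE4l3 (X : V) : Prop :=
  InE4m F V X ∧ ∀ W, InE4l3 F V W → InE4l3 F V (lie F V W X)

end acm

/-- A 3-quasi-Sasakian structure: each of the three almost contact metric
structures is quasi-Sasakian.  We also record, as part of the structure, the
standard structural facts established for such manifolds in the literature
(Cappelletti Montano–De Nicola–Dileo): the Reeb commutation relations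
`[ξ_α, ξ_β] = c ξ_γ`, the splitting `H = E^{4l} ⊕ E^{4m}` (constancy of the
rank), the `φ_α`-invariance of both distributions, and the tensors `ψ_α`
(equal to `φ_α` on `E^{4l+3}` and vanishing on `E^{4m}` when the rank is
`4l+3`, i.e. `c ≠ 0`; equal to `φ_α` on `E^{4l}` and vanishing on `E^{4m+3}`
when the rank is `4l+1`, i.e. `c = 0`). -/
class ThreeQS (F V : Type) [CommRing F] [Algebra ℝ F] [AddCommGroup V] [Module F V]
    [SmoothSetting F V] [ACM3 F V] where
  qs : ∀ α, IsQuasiSasakian F V α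
  c : ℝ
  reeb_bracket : ∀ a b c', Cyclic a b c' →
    lie F V (rxi F V a) (rxi F V b) = algebraMap ℝ F c • rxi F V c'
  horiz_split : ∀ X, Horiz F V X → ∃ Y Z, InE4l F V Y ∧ InE4m F V Z ∧ X = Y + Z
  phi_E4l : ∀ α X, InE4l F V X → InE4l F V (ph F V α X)
  phi_E4m : ∀ α X, InE4m F V X → InE4m F V (ph F V α X)
  psi : Fin 3 → V → V
  psi_add : ∀ α (X Y : V), psi α (X + Y) = psi α X + psi α Y
  psi_smul : ∀ α (f : F) (X : V), psi α (f • X) = f • psi α X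
  psi_E4l : ∀ α X, InE4l F V X → psi α X = ph F V α X
  psi_E4m : ∀ α X, InE4m F V X → psi α X = 0
  psi_vert_of_ne : c ≠ 0 → ∀ α β, psi α (rxi F V β) = ph F V α (rxi F V β)
  psi_vert_of_eq : c = 0 → ∀ α β, psi α (rxi F V β) = 0

section tqs

variable (F V : Type) [CommRing F] [Algebra ℝ F] [AddCommGroup V] [Module F V]
  [SmoothSetting F V] [ACM3 F V] [ThreeQS F V]

/-- The constant `c` with `[ξ_α, ξ_β] = c ξ_γ`. -/
def cc : ℝ := ThreeQS.c F V

/-- The tensors `ψ_α`. -/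
def psiT (α : Fin 3) (X : V) : V := ThreeQS.psi F α X

/-- The tensors `θ_α = φ_α - ψ_α`. -/
def thetaT (α : Fin 3) (X : V) : V := ph F V α X - psiT F V α X

/-- The 2-forms `Θ_α(X,Y) = g(X, θ_α Y)`. -/
def ThetaForm (α : Fin 3) (X Y : V) : F := gm F V X (thetaT F V α Y)

end tqs

/-- The 3-quasi-Sasakian manifold has rank `4l+3`: the constant `c` is nonzero
and the orthonormal frame is adapted to the splitting
`TM = E^{4l} ⊕ E^{4m} ⊕ ⟨ξ₁,ξ₂,ξ₃⟩` with `dim E^{4l} = 4l` (hence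
`dim E^{4m} = 4m`, `m = n - l`, and the rank of the `η_α` is `4l+3`). -/
class HasRank (F V : Type) [CommRing F] [Algebra ℝ F] [AddCommGroup V] [Module F V]
    [SmoothSetting F V] [ACM3 F V] [ThreeQS F V] (l : ℕ) : Prop where
  c_ne : cc F V ≠ 0
  l_le : l ≤ dimn F V
  frame_E4l : ∀ i : Fin (4 * dimn F V + 3), i.val < 4 * l → InE4l F V (fr F V i)
  frame_E4m : ∀ i : Fin (4 * dimn F V + 3), 4 * l ≤ i.val → i.val < 4 * dimn F V →
    InE4m F V (fr F V i)
  frame_xi : ∀ (i : Fin (4 * dimn F V + 3)) (a : Fin 3),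
    i.val = 4 * dimn F V + a.val → fr F V i = rxi F V a

/-- The Levi-Civita connection of `g`: the unique torsion-free metric connection. -/
class LeviCivita (F V : Type) [CommRing F] [Algebra ℝ F] [AddCommGroup V] [Module F V]
    [SmoothSetting F V] [ACM3 F V] where
  nabla : V → V → V
  nabla_addLeft : ∀ X Y Z : V, nabla (X + Y) Z = nabla X Z + nabla Y Z
  nabla_smulLeft : ∀ (f : F) (X Y : V), nabla (f • X) Y = f • nabla X Y
  nabla_addRight : ∀ X Y Z : V, nabla X (Y + Z) = nabla X Y + nabla X Z
  nabla_leibniz : ∀ (X : V) (f : F) (Y : V),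
    nabla X (f • Y) = der F V X f • Y + f • nabla X Y
  nabla_metric : ∀ X Y Z : V,
    der F V X (gm F V Y Z) = gm F V (nabla X Y) Z + gm F V Y (nabla X Z)
  nabla_torsionFree : ∀ X Y : V, nabla X Y - nabla Y X = lie F V X Y

section curv

variable (F V : Type) [CommRing F] [Algebra ℝ F] [AddCommGroup V] [Module F V]
  [SmoothSetting F V] [ACM3 F V] [LeviCivita F V]

/-- The Levi-Civita covariant derivative `∇_X Y`. -/
def nab (X Y : V) : V := LeviCivita.nabla F X Y

/-- The Riemannian curvature `R(X,Y)Z = ∇_X ∇_Y Z - ∇_Y ∇_X Z - ∇_{[X,Y]} Z`. -/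
def Rcurv (X Y Z : V) : V :=
  nab F V X (nab F V Y Z) - nab F V Y (nab F V X Z) - nab F V (lie F V X Y) Z

/-- The Ricci tensor `Ric(X,Y) = ∑_i g(R(e_i, X)Y, e_i)`. -/
def Ric (X Y : V) : F :=
  ∑ i, gm F V (Rcurv F V (fr F V i) X Y) (fr F V i)

/-- The scalar curvature. -/
def Scal : F := ∑ i, Ric F V (fr F V i) (fr F V i)

/-- `M` is Einstein: `Ric = a g` for a constant `a`. -/
def Einstein : Prop :=
  ∃ a : ℝ, ∀ X Y, Ric F V X Y = algebraMap ℝ F a * gm F V X Y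

/-- `M` is η-Einstein: `Ric = a g + b ∑_α η_α ⊗ η_α` for constants `a, b`. -/
def EtaEinstein : Prop :=
  ∃ a b : ℝ, ∀ X Y, Ric F V X Y
    = algebraMap ℝ F a * gm F V X Y
      + algebraMap ℝ F b * ∑ α : Fin 3, et F V α X * et F V α Y

end curv

/-- A (Koszul) linear connection on vector fields. -/
def IsConnection (F V : Type) [CommRing F] [Algebra ℝ F] [AddCommGroup V] [Module F V]
    [SmoothSetting F V] (D : V → V → V) : Prop :=
  (∀ X Y Z : V, D (X + Y) Z = D X Z + D Y Z) ∧
  (∀ (f : F) (X Y : V), D (f • X) Y = f • D X Y) ∧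
  (∀ X Y Z : V, D X (Y + Z) = D X Y + D X Z) ∧
  (∀ (X : V) (f : F) (Y : V), D X (f • Y) = der F V X f • Y + f • D X Y)

end QS3

namespace QS3

section wedge

variable {F V : Type} [CommRing F] [AddCommGroup V] [Module F V]

/-- The wedge product of two scalar-valued alternating forms. -/
def wedgeF {a b : ℕ} (ω : V [⋀^Fin a]→ₗ[F] F) (τ : V [⋀^Fin b]→ₗ[F] F) :
    V [⋀^Fin (a + b)]→ₗ[F] F :=
  AlternatingMap.domDomCongr finSumFinEquiv
    ((LinearMap.mul' F F).compAlternatingMap (AlternatingMap.domCoprod ω τ))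

/-- The `k`-th wedge power of a 2-form. -/
def wpow (ω : V [⋀^Fin 2]→ₗ[F] F) : (k : ℕ) → V [⋀^Fin (2 * k)]→ₗ[F] F
  | 0 => AlternatingMap.constOfIsEmpty F V (Fin 0) 1
  | k + 1 => wedgeF (wpow ω k) ω

end wedge

section algebra

variable {F V : Type} [CommRing F] [Algebra ℝ F] [AddCommGroup V] [Module F V]
  [SmoothSetting F V]

theorem der_add_right (X : V) (f h : F) : der F V X (f + h) = der F V X f + der F V X h :=
  SmoothSetting.act_add X f h

theorem der_mul (X : V) (f h : F) : der F V X (f * h) = der F V X f * h + f * der F V X h :=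
  SmoothSetting.act_mul X f h

theorem der_const (X : V) (r : ℝ) : der F V X (algebraMap ℝ F r) = 0 :=
  SmoothSetting.act_const X r

theorem der_zero_right (X : V) : der F V X (0 : F) = 0 := by
  simpa using der_const (F := F) X 0

theorem der_one (X : V) : der F V X (1 : F) = 0 := by
  simpa using der_const (F := F) X 1

theorem der_neg_right (X : V) (f : F) : der F V X (-f) = -der F V X f :=
  (AddMonoidHom.mk' (der F V X) (der_add_right X)).map_neg f

theorem der_sub_right (X : V) (f h : F) : der F V X (f - h) = der F V X f - der F V X h :=
  (AddMonoidHom.mk' (der F V X) (der_add_right X)).map_sub f h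

theorem lie_skew (X Y : V) : lie F V X Y = -lie F V Y X :=
  SmoothSetting.bracket_antisymm X Y

theorem lie_add_left (X Y Z : V) : lie F V (X + Y) Z = lie F V X Z + lie F V Y Z :=
  SmoothSetting.bracket_addLeft X Y Z

theorem lie_add_right (X Y Z : V) : lie F V X (Y + Z) = lie F V X Y + lie F V X Z := by
  rw [lie_skew, lie_add_left, lie_skew Y, lie_skew Z]
  abel

theorem lie_neg_right (X Y : V) : lie F V X (-Y) = -lie F V X Y :=
  (AddMonoidHom.mk' (lie F V X) (lie_add_right X)).map_neg Y

theorem lie_sub_right (X Y Z : V) : lie F V X (Y - Z) = lie F V X Y - lie F V X Z :=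
  (AddMonoidHom.mk' (lie F V X) (lie_add_right X)).map_sub Y Z

theorem lie_neg_left (X Y : V) : lie F V (-X) Y = -lie F V X Y := by
  rw [lie_skew, lie_neg_right, neg_neg, lie_skew]

theorem lie_smul_right (X : V) (f : F) (Y : V) :
    lie F V X (f • Y) = f • lie F V X Y + der F V X f • Y :=
  SmoothSetting.bracket_smulRight X f Y

theorem lie_const_smul_left (r : ℝ) (X Y : V) :
    lie F V (algebraMap ℝ F r • X) Y = algebraMap ℝ F r • lie F V X Y := by
  rw [lie_skew, lie_smul_right, der_const, lie_skew Y X]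
  simp

theorem der_lie (X Y : V) (f : F) :
    der F V (lie F V X Y) f = der F V X (der F V Y f) - der F V Y (der F V X f) :=
  SmoothSetting.bracket_act X Y f

theorem lie_jacobi (X Y Z : V) :
    lie F V X (lie F V Y Z) + lie F V Y (lie F V Z X) + lie F V Z (lie F V X Y) = 0 :=
  SmoothSetting.jacobi X Y Z

/-- Twice the exterior differential of a 1-form. -/
def dTwice (θ : V → F) (X Y : V) : F :=
  der F V X (θ Y) - der F V Y (θ X) - θ (lie F V X Y)

theorem dTwice_eq (θ : V → F) (X Y : V) : dTwice θ X Y = (2 : ℝ) • dOne F V θ X Y := by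
  simp [dTwice, dOne, smul_smul]

theorem dOne_eq (θ : V → F) (X Y : V) : dOne F V θ X Y = (2 : ℝ)⁻¹ • dTwice θ X Y := rfl

theorem dTwice_closed (θ : V → F) (hadd : ∀ X Y, θ (X + Y) = θ X + θ Y) (X Y Z : V) :
    dTwo F V (dTwice θ) X Y Z = 0 := by
  have hneg : ∀ X, θ (-X) = -θ X := (AddMonoidHom.mk' θ hadd).map_neg
  have h1 := congrArg θ (lie_jacobi (F := F) X Y Z)
  have hzero : θ 0 = 0 := (AddMonoidHom.mk' θ hadd).map_zero
  rw [hadd, hadd, hzero] at h1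
  have h2 : ∀ X Y Z : V, θ (lie F V (lie F V X Y) Z) = -θ (lie F V Z (lie F V X Y)) := by
    intro X Y Z
    rw [lie_skew, hneg]
  unfold dTwo dTwice
  simp only [der_sub_right, der_lie, h2]
  rw [smul_eq_zero_of_right]
  linear_combination -h1

end algebra

section acm

variable {F V : Type} [CommRing F] [Algebra ℝ F] [AddCommGroup V] [Module F V]
  [SmoothSetting F V] [ACM3 F V]

theorem gm_symm (X Y : V) : gm F V X Y = gm F V Y X := ACM3.g_symm X Y

theorem gm_add_left (X Y Z : V) : gm F V (X + Y) Z = gm F V X Z + gm F V Y Z :=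
  ACM3.g_addLeft X Y Z

theorem gm_smul_left (f : F) (X Y : V) : gm F V (f • X) Y = f * gm F V X Y :=
  ACM3.g_smulLeft f X Y

variable (F V) in
/-- The metric as a bilinear map. -/
def gmL : V →ₗ[F] V →ₗ[F] F :=
  LinearMap.mk₂ F (gm F V) gm_add_left gm_smul_left
    (fun X Y Z => by rw [gm_symm, gm_add_left, gm_symm Y, gm_symm Z])
    (fun f X Y => by rw [gm_symm, gm_smul_left, gm_symm Y, smul_eq_mul])

theorem gmL_apply (X Y : V) : gmL F V X Y = gm F V X Y := rfl

theorem gm_add_right (X Y Z : V) : gm F V X (Y + Z) = gm F V X Y + gm F V X Z :=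
  (gmL F V X).map_add Y Z

theorem gm_smul_right (f : F) (X Y : V) : gm F V X (f • Y) = f * gm F V X Y :=
  (gmL F V X).map_smul f Y

theorem gm_neg_right (X Y : V) : gm F V X (-Y) = -gm F V X Y := (gmL F V X).map_neg Y

theorem gm_sub_right (X Y Z : V) : gm F V X (Y - Z) = gm F V X Y - gm F V X Z :=
  (gmL F V X).map_sub Y Z

theorem gm_zero_right (X : V) : gm F V X 0 = 0 := (gmL F V X).map_zero

theorem gm_neg_left (X Y : V) : gm F V (-X) Y = -gm F V X Y := by
  rw [gm_symm, gm_neg_right, gm_symm]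

theorem gm_sub_left (X Y Z : V) : gm F V (X - Y) Z = gm F V X Z - gm F V Y Z := by
  rw [gm_symm, gm_sub_right, gm_symm, gm_symm Z]

theorem gm_zero_left (X : V) : gm F V 0 X = 0 := by
  rw [gm_symm, gm_zero_right]

theorem eq_of_gm_right (X Y : V) (h : ∀ W, gm F V W X = gm F V W Y) : X = Y := by
  rw [← sub_eq_zero]
  refine ACM3.g_nondeg (F := F) _ fun W => ?_
  change gm F V (X - Y) W = 0
  rw [gm_symm, gm_sub_right, h, sub_self]

variable (F V) in
/-- The structure tensors as linear maps. -/
def phL (a : Fin 3) : V →ₗ[F] V where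
  toFun := ph F V a
  map_add' := ACM3.phi_add a
  map_smul' := ACM3.phi_smul a

theorem ph_add (a : Fin 3) (X Y : V) : ph F V a (X + Y) = ph F V a X + ph F V a Y :=
  (phL F V a).map_add X Y

theorem ph_smul (a : Fin 3) (f : F) (X : V) : ph F V a (f • X) = f • ph F V a X :=
  (phL F V a).map_smul f X

theorem ph_neg (a : Fin 3) (X : V) : ph F V a (-X) = -ph F V a X := (phL F V a).map_neg X

theorem ph_sub (a : Fin 3) (X Y : V) : ph F V a (X - Y) = ph F V a X - ph F V a Y :=
  (phL F V a).map_sub X Y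

theorem ph_zero (a : Fin 3) : ph F V a (0 : V) = 0 := (phL F V a).map_zero

theorem et_eq_gm (a : Fin 3) (X : V) : et F V a X = gm F V X (rxi F V a) := ACM3.eta_eq a X

theorem et_add (a : Fin 3) (X Y : V) : et F V a (X + Y) = et F V a X + et F V a Y := by
  simp only [et_eq_gm, gm_add_left]

theorem et_smul (a : Fin 3) (f : F) (X : V) : et F V a (f • X) = f * et F V a X := by
  simp only [et_eq_gm, gm_smul_left]

theorem et_neg (a : Fin 3) (X : V) : et F V a (-X) = -et F V a X := by
  simp only [et_eq_gm, gm_neg_left]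

theorem et_sub (a : Fin 3) (X Y : V) : et F V a (X - Y) = et F V a X - et F V a Y := by
  simp only [et_eq_gm, gm_sub_left]

theorem et_zero (a : Fin 3) : et F V a (0 : V) = 0 := by
  simp only [et_eq_gm, gm_zero_left]

theorem ph_ph (a : Fin 3) (X : V) : ph F V a (ph F V a X) = -X + et F V a X • rxi F V a :=
  ACM3.acm_sq a X

theorem et_xi_self (a : Fin 3) : et F V a (rxi F V a) = 1 := ACM3.eta_xi a

theorem gm_ph_ph (a : Fin 3) (X Y : V) :
    gm F V (ph F V a X) (ph F V a Y) = gm F V X Y - et F V a X * et F V a Y :=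
  ACM3.compat a X Y

theorem Cyclic.rotate {a b c : Fin 3} (h : Cyclic a b c) : Cyclic b c a := by
  simp only [Cyclic, Prod.mk.injEq] at *
  tauto

theorem exists_cyclic (a : Fin 3) : ∃ b c, Cyclic a b c := by
  fin_cases a
  · exact ⟨1, 2, by simp [Cyclic]⟩
  · exact ⟨2, 0, by simp [Cyclic]⟩
  · exact ⟨0, 1, by simp [Cyclic]⟩

theorem Cyclic.forall_iff {a b c : Fin 3} (h : Cyclic a b c) (p : Fin 3 → Prop) :
    (∀ i, p i) ↔ p a ∧ p b ∧ p c := by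
  rw [Fin.forall_fin_succ, Fin.forall_fin_two]
  simp only [Cyclic, Prod.mk.injEq] at h
  obtain ⟨rfl, rfl, rfl⟩ | ⟨rfl, rfl, rfl⟩ | ⟨rfl, rfl, rfl⟩ := h <;>
    simp <;> tauto

section cyclic

variable {a b c : Fin 3}

theorem ph_xi_next (h : Cyclic a b c) : ph F V a (rxi F V b) = rxi F V c :=
  (ACM3.quat_xi a b c h).symm

theorem ph_xi_prev (h : Cyclic a b c) : ph F V b (rxi F V a) = -rxi F V c := by
  have h1 : rxi F V c = -ph F V b (rxi F V a) := ACM3.quat_xi' a b c h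
  rw [h1, neg_neg]

theorem et_ph_next (h : Cyclic a b c) (X : V) : et F V a (ph F V b X) = et F V c X :=
  (ACM3.quat_eta a b c h X).symm

theorem et_ph_prev (h : Cyclic a b c) (X : V) : et F V b (ph F V a X) = -et F V c X := by
  have h1 : et F V c X = -et F V b (ph F V a X) := ACM3.quat_eta' a b c h X
  rw [h1, neg_neg]

theorem et_xi_next (h : Cyclic a b c) : et F V a (rxi F V b) = 0 := by
  have h1 := ph_ph (F := F) a (rxi F V b)
  rw [ph_xi_next h, ph_xi_prev h.rotate.rotate, left_eq_add] at h1
  have h2 := congrArg (et F V a) h1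
  rwa [et_smul, et_xi_self, mul_one, et_zero] at h2

theorem et_xi_prev (h : Cyclic a b c) : et F V b (rxi F V a) = 0 := by
  rw [et_eq_gm, gm_symm, ← et_eq_gm, et_xi_next h]

end cyclic

theorem ph_xi_self (a : Fin 3) : ph F V a (rxi F V a) = 0 := by
  obtain ⟨b, c, h⟩ := exists_cyclic a
  have h1 : ph F V a (rxi F V a)
      = ph F V b (ph F V c (rxi F V a)) - et F V c (rxi F V a) • rxi F V b :=
    ACM3.quat_phi b c a h.rotate _
  rw [ph_xi_next h.rotate.rotate, et_xi_next h.rotate.rotate, zero_smul, sub_zero] at h1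
  have h2 : ∀ d, ph F V d (ph F V d (rxi F V d)) = 0 := fun d => by
    rw [ph_ph, et_xi_self, one_smul, neg_add_cancel]
  have h3 := ph_ph (F := F) a (ph F V a (rxi F V a))
  have h4 := ph_ph (F := F) b (ph F V a (rxi F V a))
  rw [h2, ph_zero] at h3
  nth_rw 1 [h1] at h4
  rw [h2, ph_zero] at h4
  have h5 := congrArg (et F V b) h3
  rw [et_add, et_smul, et_xi_prev h, et_neg, et_zero] at h5
  have h6 : et F V b (ph F V a (rxi F V a)) = 0 := by linear_combination h5
  rw [h6, zero_smul, add_zero] at h4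
  exact neg_eq_zero.mp h4.symm

theorem et_ph_self (a : Fin 3) (X : V) : et F V a (ph F V a X) = 0 := by
  have h1 := ph_ph (F := F) a (ph F V a X)
  rw [ph_ph a X, ph_add, ph_neg, ph_smul, ph_xi_self, smul_zero, add_zero, left_eq_add] at h1
  have h2 := congrArg (et F V a) h1
  rwa [et_smul, et_xi_self, mul_one, et_zero] at h2

theorem gm_ph_left (a : Fin 3) (X Y : V) : gm F V (ph F V a X) Y = -gm F V X (ph F V a Y) := by
  have h := gm_ph_ph (F := F) a X (ph F V a Y)
  rw [ph_ph, gm_add_right, gm_neg_right, gm_smul_right, ← et_eq_gm, et_ph_self, et_ph_self] at h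
  linear_combination -h

theorem Phi_skew (a : Fin 3) (X Y : V) : Phi F V a X Y = -Phi F V a Y X := by
  unfold Phi
  rw [← gm_ph_left, gm_symm]

theorem dTwice_et_skew (a : Fin 3) (X Y : V) :
    dTwice (et F V a) X Y = -dTwice (et F V a) Y X := by
  unfold dTwice
  rw [lie_skew, et_neg]
  ring

theorem Horiz.ph {X : V} (hX : Horiz F V X) (a : Fin 3) : Horiz F V (ph F V a X) := by
  obtain ⟨b, c, h⟩ := exists_cyclic a
  refine (h.forall_iff _).2 ⟨et_ph_self a X, ?_, ?_⟩
  · rw [et_ph_prev h, hX, neg_zero]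
  · rw [et_ph_next h.rotate.rotate, hX]

theorem Horiz.ph_ph {X : V} (hX : Horiz F V X) (a : Fin 3) :
    QS3.ph F V a (QS3.ph F V a X) = -X := by
  rw [QS3.ph_ph, hX, zero_smul, add_zero]

theorem Phi_xi_self (a : Fin 3) (X : V) : Phi F V a (rxi F V a) X = 0 := by
  rw [Phi, gm_symm, ← et_eq_gm, et_ph_self]

theorem Horiz.sub {X Y : V} (hX : Horiz F V X) (hY : Horiz F V Y) : Horiz F V (X - Y) :=
  fun a => by rw [et_sub, hX, hY, sub_zero]

/-- The tensor field `ℒ_{ξ_a} φ_b`. -/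
def lieXiPh (F : Type) {V : Type} [CommRing F] [Algebra ℝ F] [AddCommGroup V] [Module F V]
    [SmoothSetting F V] [ACM3 F V] (a b : Fin 3) (X : V) : V :=
  lie F V (rxi F V a) (ph F V b X) - ph F V b (lie F V (rxi F V a) X)

theorem lieXiPh_sub (a b : Fin 3) (X Y : V) :
    lieXiPh F a b (X - Y) = lieXiPh F a b X - lieXiPh F a b Y := by
  simp only [lieXiPh, ph_sub, lie_sub_right]
  abel

theorem lieXiPh_smul (a b : Fin 3) (f : F) (X : V) :
    lieXiPh F a b (f • X) = f • lieXiPh F a b X := by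
  simp only [lieXiPh, ph_smul, lie_smul_right, ph_add, smul_sub]
  abel

theorem dTwice_of_InE4m {Z : V} (hZ : InE4m F V Z) (d : Fin 3) (Y : V) :
    dTwice (et F V d) Z Y = 0 := by
  rw [dTwice_eq, hZ.2, smul_zero]

theorem gm_sum_xi_of_horiz {X : V} (hX : Horiz F V X) (f : Fin 3 → F) :
    gm F V X (∑ d : Fin 3, f d • rxi F V d) = 0 := by
  simp only [Fin.sum_univ_three, gm_add_right, gm_smul_right, ← et_eq_gm, hX _, mul_zero, add_zero]

end acm

section tqs

variable {F V : Type} [CommRing F] [Algebra ℝ F] [AddCommGroup V] [Module F V]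
  [SmoothSetting F V] [ACM3 F V] [ThreeQS F V]

theorem NOne_xi (a b : Fin 3) (X : V) :
    ph F V b (ph F V b (lie F V (rxi F V a) X))
      + lie F V (ph F V b (rxi F V a)) (ph F V b X)
      - ph F V b (lie F V (ph F V b (rxi F V a)) X) - ph F V b (lie F V (rxi F V a) (ph F V b X))
      + dTwice (et F V b) (rxi F V a) X • rxi F V b = 0 := by
  rw [dTwice_eq]
  exact (ThreeQS.qs b).1 (rxi F V a) X

theorem dTwice_et_xi_self (a : Fin 3) (X : V) : dTwice (et F V a) (rxi F V a) X = 0 := by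
  have h := congrArg (et F V a) (NOne_xi (F := F) a a X)
  have hl : ∀ Y, lie F V (0 : V) Y = 0 := fun Y => by
    rw [← zero_smul F (0 : V), ← (algebraMap ℝ F).map_zero, lie_const_smul_left]
    simp
  rw [ph_xi_self, hl, hl] at h
  simpa [et_add, et_sub, et_smul, et_ph_self, et_xi_self, et_zero, ph_zero] using h

theorem et_lie_xi_self (a : Fin 3) (X : V) :
    et F V a (lie F V (rxi F V a) X) = der F V (rxi F V a) (et F V a X) := by
  have h := dTwice_et_xi_self (F := F) a X
  rw [dTwice, et_xi_self, der_one] at h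
  linear_combination -h

theorem lieXiPh_self (a : Fin 3) (X : V) : lieXiPh F a a X = 0 := by
  have h := NOne_xi (F := F) a a X
  have hl : ∀ Y, lie F V (0 : V) Y = 0 := fun Y => by
    rw [← zero_smul F (0 : V), ← (algebraMap ℝ F).map_zero, lie_const_smul_left]
    simp
  rw [ph_xi_self, hl, hl, dTwice_et_xi_self, ph_zero, zero_smul, add_zero, add_zero, sub_zero,
    ← ph_sub, ← neg_sub, ph_neg, neg_eq_zero] at h
  have h1 := ph_ph (F := F) a (lieXiPh F a a X)
  have h2 : ph F V a (lieXiPh F a a X) = 0 := h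
  have h3 : et F V a (lieXiPh F a a X) = 0 := by
    rw [lieXiPh, et_sub, et_ph_self, et_lie_xi_self, et_ph_self, der_zero_right, sub_zero]
  rw [h2, h3, ph_zero, zero_smul, add_zero] at h1
  exact neg_eq_zero.mp h1.symm

theorem lie_Phi (a b : Fin 3) (X Y : V) :
    der F V (rxi F V a) (Phi F V b X Y) - Phi F V b (lie F V (rxi F V a) X) Y
      - Phi F V b X (lie F V (rxi F V a) Y) = dTwice (Phi F V b (rxi F V a)) X Y := by
  have h := (ThreeQS.qs (F := F) (V := V) b).2 (rxi F V a) X Y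
  rw [dTwo] at h
  replace h := congrArg (fun f => (3 : ℝ) • f) h
  simp only [smul_smul, smul_zero] at h
  norm_num at h
  have e1 : Phi F V b Y (rxi F V a) = -Phi F V b (rxi F V a) Y := Phi_skew _ _ _
  have e2 : Phi F V b (lie F V X Y) (rxi F V a) = -Phi F V b (rxi F V a) (lie F V X Y) :=
    Phi_skew _ _ _
  have e3 : Phi F V b (lie F V Y (rxi F V a)) X = Phi F V b X (lie F V (rxi F V a) Y) := by
    rw [Phi_skew, lie_skew, Phi, ph_neg, gm_neg_right, neg_neg, Phi]
  rw [e1, e2, e3, der_neg_right] at h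
  rw [dTwice]
  linear_combination h

/-- The Reeb vector fields are Killing. -/
theorem der_xi_gm (a : Fin 3) (X Y : V) :
    der F V (rxi F V a) (gm F V X Y)
      = gm F V (lie F V (rxi F V a) X) Y + gm F V X (lie F V (rxi F V a) Y) := by
  have h1 : ∀ X Y : V, gm F V X Y = et F V a X * et F V a Y - Phi F V a X (ph F V a Y) := by
    intro X Y
    rw [Phi, ph_ph, gm_add_right, gm_neg_right, gm_smul_right, ← et_eq_gm]
    ring
  have h2 := lie_Phi (F := F) a a X (ph F V a Y)
  have h3 : Phi F V a (rxi F V a) = fun _ : V => (0 : F) := funext (Phi_xi_self a)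
  have h4 : lie F V (rxi F V a) (ph F V a Y) = ph F V a (lie F V (rxi F V a) Y) :=
    sub_eq_zero.mp (lieXiPh_self a Y)
  rw [h3, h4, dTwice, der_zero_right, der_zero_right] at h2
  rw [h1 X Y, h1 _ Y, h1 X, der_sub_right, der_mul, et_lie_xi_self, et_lie_xi_self]
  linear_combination -h2

theorem gm_lieXiPh (a b : Fin 3) (X Y : V) :
    gm F V X (lieXiPh F a b Y) = dTwice (Phi F V b (rxi F V a)) X Y := by
  rw [← lie_Phi, lieXiPh, gm_sub_right, Phi, der_xi_gm, Phi, Phi]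
  ring

section cyclic

variable {a b c : Fin 3}

theorem gm_lieXiPh_next (h : Cyclic a b c) (X Y : V) :
    gm F V X (lieXiPh F a b Y) = dTwice (et F V c) X Y := by
  rw [gm_lieXiPh]
  congr 1
  funext Z
  rw [Phi, gm_symm, ← et_eq_gm, et_ph_next h]

theorem lieXiPh_prev (h : Cyclic a b c) (X : V) : lieXiPh F b a X = -lieXiPh F a b X := by
  refine eq_of_gm_right (F := F) _ _ fun W => ?_
  have : Phi F V a (rxi F V b) = fun Z => -et F V c Z := by
    funext Z
    rw [Phi, gm_symm, ← et_eq_gm, et_ph_prev h]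
  rw [gm_neg_right, gm_lieXiPh_next h, gm_lieXiPh, this, dTwice, dTwice, der_neg_right,
    der_neg_right]
  ring

theorem lie_xi_xi (h : Cyclic a b c) :
    lie F V (rxi F V a) (rxi F V b) = algebraMap ℝ F (cc F V) • rxi F V c :=
  ThreeQS.reeb_bracket a b c h

theorem et_lie_xi_next (h : Cyclic a b c) (X : V) :
    et F V b (lie F V (rxi F V a) X)
      = der F V (rxi F V a) (et F V b X) - algebraMap ℝ F (cc F V) * et F V c X := by
  rw [et_eq_gm b X, der_xi_gm, lie_xi_xi h, gm_smul_right, ← et_eq_gm, ← et_eq_gm]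
  ring

theorem et_lie_xi_prev (h : Cyclic a b c) (X : V) :
    et F V a (lie F V (rxi F V b) X)
      = der F V (rxi F V b) (et F V a X) + algebraMap ℝ F (cc F V) * et F V c X := by
  rw [et_eq_gm a X, der_xi_gm, lie_skew (rxi F V b) (rxi F V a), lie_xi_xi h, gm_neg_right,
    gm_smul_right, ← et_eq_gm, ← et_eq_gm]
  ring

theorem dTwice_et_xi_next (h : Cyclic a b c) (X : V) :
    dTwice (et F V b) (rxi F V a) X = algebraMap ℝ F (cc F V) * et F V c X := by
  rw [dTwice, et_lie_xi_next h, et_xi_prev h, der_zero_right]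
  ring

theorem dTwice_et_xi_prev (h : Cyclic a b c) (X : V) :
    dTwice (et F V a) (rxi F V b) X = -(algebraMap ℝ F (cc F V) * et F V c X) := by
  rw [dTwice, et_lie_xi_prev h, et_xi_next h, der_zero_right]
  ring

theorem lieXiPh_rotate (h : Cyclic a b c) {X : V} (hX : Horiz F V X) :
    lieXiPh F b c X = ph F V b (lieXiPh F a b X) := by
  have h1 := NOne_xi (F := F) a b X
  rw [dTwice_et_xi_next h, hX, mul_zero, zero_smul, ph_xi_prev h, lie_neg_left, lie_neg_left,
    ph_neg] at h1
  have h2 := lieXiPh_prev (F := F) h.rotate X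
  rw [lieXiPh] at h2
  rw [← sub_eq_zero, ← neg_eq_iff_eq_neg.mpr h2, lieXiPh, ph_sub, ← h1]
  abel

theorem Horiz.lie_xi {X : V} (hX : Horiz F V X) (a : Fin 3) :
    Horiz F V (lie F V (rxi F V a) X) := by
  obtain ⟨b, c, h⟩ := exists_cyclic a
  refine (h.forall_iff _).2 ⟨?_, ?_, ?_⟩
  · rw [et_lie_xi_self, hX, der_zero_right]
  · rw [et_lie_xi_next h, hX, hX, der_zero_right, mul_zero, sub_zero]
  · rw [et_lie_xi_prev h.rotate.rotate, hX, hX, der_zero_right, mul_zero, add_zero]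

theorem Horiz.lieXiPh {X : V} (hX : Horiz F V X) (a b : Fin 3) :
    Horiz F V (lieXiPh F a b X) :=
  ((hX.ph b).lie_xi a).sub ((hX.lie_xi a).ph b)

theorem lieXiPh_ph {X : V} (hX : Horiz F V X) (a b : Fin 3) :
    lieXiPh F a b (ph F V b X) = -ph F V b (lieXiPh F a b X) := by
  rw [lieXiPh, lieXiPh, hX.ph_ph, ph_sub, (hX.lie_xi a).ph_ph, lie_neg_right]
  abel

theorem lie_xi_lie_xi (h : Cyclic a b c) (X : V) :
    lie F V (rxi F V a) (lie F V (rxi F V b) X) - lie F V (rxi F V b) (lie F V (rxi F V a) X)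
      = algebraMap ℝ F (cc F V) • lie F V (rxi F V c) X := by
  have h1 := lie_jacobi (F := F) (rxi F V a) (rxi F V b) X
  rw [lie_xi_xi h, lie_skew X (rxi F V a), lie_neg_right, lie_skew X, lie_const_smul_left] at h1
  rw [← sub_eq_zero, ← h1]
  abel

theorem lie_lieXiPh (h : Cyclic a b c) (d : Fin 3) (X : V) :
    (lie F V (rxi F V a) (lieXiPh F b d X) - lieXiPh F b d (lie F V (rxi F V a) X))
      - (lie F V (rxi F V b) (lieXiPh F a d X) - lieXiPh F a d (lie F V (rxi F V b) X))
      = algebraMap ℝ F (cc F V) • lieXiPh F c d X := by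
  have h1 := lie_xi_lie_xi (F := F) h (ph F V d X)
  have h2 := congrArg (ph F V d) (lie_xi_lie_xi (F := F) h X)
  rw [ph_sub, ph_smul] at h2
  simp only [lieXiPh, lie_sub_right, smul_sub]
  rw [← h1, ← h2]
  abel

theorem lie_lieXiPh_add (h : Cyclic a b c) (X : V) :
    (lie F V (rxi F V a) (lieXiPh F b c X) - lieXiPh F b c (lie F V (rxi F V a) X))
      + (lie F V (rxi F V b) (lieXiPh F c a X) - lieXiPh F c a (lie F V (rxi F V b) X)) = 0 := by
  have h1 := lie_lieXiPh (F := F) h c X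
  rw [lieXiPh_self, smul_zero, lieXiPh_prev h.rotate.rotate, lieXiPh_prev h.rotate.rotate,
    lie_neg_right] at h1
  rw [← h1]
  abel

theorem lie_xi_lieXiPh (h : Cyclic a b c) (X : V) :
    lie F V (rxi F V a) (lieXiPh F b c X) = lieXiPh F b c (lie F V (rxi F V a) X) := by
  have h1 := lie_lieXiPh_add (F := F) h X
  have h2 := lie_lieXiPh_add (F := F) h.rotate X
  have h3 := lie_lieXiPh_add (F := F) h.rotate.rotate X
  rw [← sub_eq_zero]
  set x := lie F V (rxi F V a) (lieXiPh F b c X) - lieXiPh F b c (lie F V (rxi F V a) X)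
  set y := lie F V (rxi F V b) (lieXiPh F c a X) - lieXiPh F c a (lie F V (rxi F V b) X)
  set z := lie F V (rxi F V c) (lieXiPh F a b X) - lieXiPh F a b (lie F V (rxi F V c) X)
  have h4 : (algebraMap ℝ F 2) • x = 0 := by
    have : x + x = (x + y) - (y + z) + (z + x) := by abel
    rw [map_ofNat, two_smul, this, h1, h2, h3, sub_zero, add_zero]
  have h5 := congrArg (fun y => algebraMap ℝ F 2⁻¹ • y) h4
  simp only [smul_smul, ← map_mul, smul_zero] at h5
  rwa [inv_mul_cancel₀ two_ne_zero, map_one, one_smul] at h5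

theorem lieXiPh_lieXiPh (h : Cyclic a b c) {X : V} (hX : Horiz F V X) :
    lieXiPh F a b (lieXiPh F b c X) = algebraMap ℝ F (cc F V) • lieXiPh F c a X := by
  have hroll : ∀ {Y : V}, Horiz F V Y → lieXiPh F a b Y = -ph F V b (lieXiPh F b c Y) := by
    intro Y hY
    rw [lieXiPh_rotate h hY, (hY.lieXiPh a b).ph_ph, neg_neg]
  have h1 := lie_lieXiPh (F := F) h a X
  rw [lieXiPh_self, lieXiPh_self, lieXiPh_prev h, lieXiPh_prev h] at h1
  have h2 := hroll hX
  have h3 := hroll (hX.lie_xi a)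
  have h4 : lieXiPh F a b (lieXiPh F b c X)
      = lie F V (rxi F V a) (ph F V b (lieXiPh F b c X))
        - ph F V b (lieXiPh F b c (lie F V (rxi F V a) X)) := by
    rw [← lie_xi_lieXiPh h]
    rfl
  have hz : lie F V (rxi F V b) (0 : V) = 0 := by
    simpa using lie_smul_right (rxi F V b) (0 : F) (0 : V)
  rw [← h1, h4, h2, h3, hz]
  simp only [lie_neg_right]
  abel

theorem lieXiPh_ph_left (h : Cyclic a b c) {X : V} (hX : Horiz F V X) :
    lieXiPh F a b (ph F V a X) = lieXiPh F c a X := by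
  have h1 : ∀ Y : V, lieXiPh F a b Y = -lieXiPh F b a Y := fun Y => by
    rw [lieXiPh_prev h, neg_neg]
  rw [h1, lieXiPh_ph hX, lieXiPh_prev h, lieXiPh_rotate h.rotate.rotate hX, ph_neg, neg_neg,
    (hX.lieXiPh c a).ph_ph, neg_neg]

theorem exists_decomposition (X : V) :
    ∃ Y Z, InE4l F V Y ∧ InE4m F V Z ∧ X = Y + Z + ∑ d : Fin 3, et F V d X • rxi F V d := by
  have hX : Horiz F V (X - ∑ d : Fin 3, et F V d X • rxi F V d) := by
    have h0 : Cyclic 0 1 2 := Or.inl rfl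
    have h1 := h0.rotate
    have h2 := h1.rotate
    refine (h0.forall_iff _).2 ⟨?_, ?_, ?_⟩ <;>
      simp [Fin.sum_univ_three, et_sub, et_add, et_smul, et_xi_self, et_xi_next h0, et_xi_next h1,
        et_xi_next h2, et_xi_prev h0, et_xi_prev h1, et_xi_prev h2]
  obtain ⟨Y, Z, hY, hZ, h⟩ := ThreeQS.horiz_split _ hX
  exact ⟨Y, Z, hY, hZ, by rw [← h, sub_add_cancel]⟩

theorem eq_zero_of_InE4l_of_InE4m {X : V} (hl : InE4l F V X) (hm : InE4m F V X) : X = 0 := by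
  refine ACM3.g_nondeg (F := F) X fun W => ?_
  obtain ⟨Y, Z, hY, hZ, h⟩ := exists_decomposition (F := F) W
  change gm F V X W = 0
  rw [h, gm_add_right, gm_add_right, hl.2 Z hZ, gm_symm, hY.2 X hm, gm_sum_xi_of_horiz hl.1,
    add_zero, add_zero]

theorem lieXiPh_E4l (h : Cyclic a b c) {X : V} (hX : InE4l F V X) :
    lieXiPh F b c X = algebraMap ℝ F (cc F V) • ph F V a X := by
  rw [← sub_eq_zero]
  set k := algebraMap ℝ F (cc F V)
  set Z := lieXiPh F b c X - k • ph F V a X with hZ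
  have hZh : Horiz F V Z := (hX.1.lieXiPh b c).sub fun d => by
    rw [et_smul, hX.1.ph, mul_zero]
  have h1 : lieXiPh F a b Z = 0 := by
    rw [hZ, lieXiPh_sub, lieXiPh_lieXiPh h hX.1, lieXiPh_smul, lieXiPh_ph_left h hX.1, sub_self]
  have h2 : lieXiPh F b c Z = 0 := by rw [lieXiPh_rotate h hZh, h1, ph_zero]
  have h3 : lieXiPh F c a Z = 0 := by rw [lieXiPh_rotate h.rotate hZh, h2, ph_zero]
  have hd : ∀ d W, dTwice (et F V d) Z W = 0 := by
    refine (h.forall_iff _).2 ⟨fun W => ?_, fun W => ?_, fun W => ?_⟩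
    · rw [dTwice_et_skew, ← gm_lieXiPh_next h.rotate, h2, gm_zero_right, neg_zero]
    · rw [dTwice_et_skew, ← gm_lieXiPh_next h.rotate.rotate, h3, gm_zero_right, neg_zero]
    · rw [dTwice_et_skew, ← gm_lieXiPh_next h, h1, gm_zero_right, neg_zero]
  refine eq_zero_of_InE4l_of_InE4m (F := F) ⟨hZh, fun W hW => ?_⟩
    ⟨hZh, fun d W => by rw [dOne_eq, hd, smul_zero]⟩
  rw [hZ, gm_sub_left, gm_symm, gm_lieXiPh_next h.rotate, dTwice_of_InE4m hW, gm_smul_left,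
    (ThreeQS.phi_E4l a X hX).2 W hW, mul_zero, sub_zero]

end cyclic

theorem dTwice_E4l (a : Fin 3) (X : V) {Y : V} (hY : InE4l F V Y) :
    dTwice (et F V a) X Y = algebraMap ℝ F (cc F V) * Phi F V a X Y := by
  obtain ⟨b, c, h⟩ := exists_cyclic a
  rw [← gm_lieXiPh_next h.rotate, lieXiPh_E4l h hY, gm_smul_right, Phi]

theorem dTwice_xi (a d : Fin 3) (X : V) :
    dTwice (et F V a) X (rxi F V d) = algebraMap ℝ F (cc F V) * Phi F V a X (rxi F V d) := by
  obtain ⟨b, c, h⟩ := exists_cyclic a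
  revert d
  refine (h.forall_iff _).2 ⟨?_, ?_, ?_⟩
  · rw [dTwice_et_skew, dTwice_et_xi_self, Phi, ph_xi_self, gm_zero_right, mul_zero, neg_zero]
  · rw [dTwice_et_skew, dTwice_et_xi_prev h, Phi, ph_xi_next h, et_eq_gm, neg_neg]
  · rw [dTwice_et_skew, dTwice_et_xi_next h.rotate.rotate, Phi, ph_xi_prev h.rotate.rotate,
      gm_neg_right, et_eq_gm, mul_neg]

theorem dTwice_et_add_right (a : Fin 3) (X Y Z : V) :
    dTwice (et F V a) X (Y + Z) = dTwice (et F V a) X Y + dTwice (et F V a) X Z := by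
  obtain ⟨b, c, h⟩ := exists_cyclic a
  simp only [← gm_lieXiPh_next h.rotate, lieXiPh, ph_add, lie_add_right, gm_add_right,
    gm_sub_right]
  ring

theorem dTwice_et_smul_right (a : Fin 3) (f : F) (X Y : V) :
    dTwice (et F V a) X (f • Y) = f * dTwice (et F V a) X Y := by
  obtain ⟨b, c, h⟩ := exists_cyclic a
  rw [← gm_lieXiPh_next h.rotate, lieXiPh_smul, gm_smul_right, gm_lieXiPh_next h.rotate]

theorem psiT_add (a : Fin 3) (X Y : V) : psiT F V a (X + Y) = psiT F V a X + psiT F V a Y :=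
  ThreeQS.psi_add a X Y

theorem psiT_smul (a : Fin 3) (f : F) (X : V) : psiT F V a (f • X) = f • psiT F V a X :=
  ThreeQS.psi_smul a f X

theorem psiT_E4l (a : Fin 3) {X : V} (hX : InE4l F V X) : psiT F V a X = ph F V a X :=
  ThreeQS.psi_E4l a X hX

theorem psiT_E4m (a : Fin 3) {X : V} (hX : InE4m F V X) : psiT F V a X = 0 :=
  ThreeQS.psi_E4m a X hX

theorem psiT_xi (hc : cc F V ≠ 0) (a d : Fin 3) :
    psiT F V a (rxi F V d) = ph F V a (rxi F V d) :=
  ThreeQS.psi_vert_of_ne hc a d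

/-- In rank `4l+3`, `2 dη_a = c g(·, ψ_a ·)`. -/
theorem dTwice_eq_psi (hc : cc F V ≠ 0) (a : Fin 3) (X Y : V) :
    dTwice (et F V a) X Y = algebraMap ℝ F (cc F V) * gm F V X (psiT F V a Y) := by
  obtain ⟨Y₁, Y₂, h₁, h₂, h⟩ := exists_decomposition (F := F) Y
  rw [h]
  simp only [Fin.sum_univ_three, dTwice_et_add_right, dTwice_et_smul_right, psiT_add, psiT_smul,
    gm_add_right, gm_smul_right, dTwice_E4l a X h₁, dTwice_xi, psiT_E4l a h₁, psiT_E4m a h₂,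
    psiT_xi hc, gm_zero_right, Phi]
  rw [dTwice_et_skew, dTwice_of_InE4m h₂]
  ring

theorem ThetaForm_eq (hc : cc F V ≠ 0) (a : Fin 3) (X Y : V) :
    ThetaForm F V a X Y
      = Phi F V a X Y - algebraMap ℝ F (cc F V)⁻¹ * dTwice (et F V a) X Y := by
  rw [dTwice_eq_psi hc, ← mul_assoc, ← map_mul, inv_mul_cancel₀ hc, map_one, one_mul, ThetaForm,
    thetaT, gm_sub_right, Phi]

theorem ThetaForm_closed (hc : cc F V ≠ 0) (a : Fin 3) : IsClosedTwo F V (ThetaForm F V a) := by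
  intro X Y Z
  have h1 := (ThreeQS.qs (F := F) (V := V) a).2 X Y Z
  have h2 := dTwice_closed (F := F) (et F V a) (et_add a) X Y Z
  unfold dTwo at h1 h2 ⊢
  simp only [ThetaForm_eq hc, der_sub_right, der_mul, der_const, zero_mul, zero_add]
  rw [Algebra.smul_def] at h1 h2 ⊢
  linear_combination h1 - algebraMap ℝ F (cc F V)⁻¹ * h2

end tqs

section wedge

variable {F V : Type} [CommRing F] [AddCommGroup V] [Module F V]

theorem wedgeF_apply {a b : ℕ} (α : V [⋀^Fin a]→ₗ[F] F) (β : V [⋀^Fin b]→ₗ[F] F)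
    (v : Fin (a + b) → V) :
    wedgeF α β v = ∑ σ : Equiv.Perm.ModSumCongr (Fin a) (Fin b),
      LinearMap.mul' F F (AlternatingMap.domCoprod.summand α β σ (v ∘ finSumFinEquiv)) := by
  simp only [wedgeF, AlternatingMap.domDomCongr_apply, LinearMap.compAlternatingMap_apply,
    AlternatingMap.domCoprod_apply, sum_apply, map_sum]

theorem mul'_summand_mk {a b : ℕ} (α : V [⋀^Fin a]→ₗ[F] F) (β : V [⋀^Fin b]→ₗ[F] F)
    (σ : Equiv.Perm (Fin a ⊕ Fin b)) (v : Fin a ⊕ Fin b → V) :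
    LinearMap.mul' F F (AlternatingMap.domCoprod.summand α β (Quotient.mk'' σ) v) =
      Equiv.Perm.sign σ •
        (α (fun i => v (σ (Sum.inl i))) * β (fun i => v (σ (Sum.inr i)))) := by
  rw [AlternatingMap.domCoprod.summand_mk'', smul_apply, Units.smul_def, map_zsmul,
    ← Units.smul_def]
  simp

/-- A form whose value vanishes as soon as one of its arguments is `x`. -/
def Kills {k : ℕ} (α : V [⋀^Fin k]→ₗ[F] F) (x : V) : Prop :=
  ∀ v : Fin k → V, ∀ i, v i = x → α v = 0

theorem Kills.wedgeF {a b : ℕ} {α : V [⋀^Fin a]→ₗ[F] F} {β : V [⋀^Fin b]→ₗ[F] F} {x : V}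
    (hα : Kills α x) (hβ : Kills β x) : Kills (wedgeF α β) x := by
  intro v i hi
  rw [wedgeF_apply]
  refine Finset.sum_eq_zero fun σ _ => ?_
  induction σ using Quotient.inductionOn' with | _ σ
  rw [mul'_summand_mk]
  rcases hj : σ⁻¹ (finSumFinEquiv.symm i) with j | j
  · rw [hα _ j, zero_mul, smul_zero]
    rw [← hj]; simpa using hi
  · rw [hβ _ j, mul_zero, smul_zero]
    rw [← hj]; simpa using hi

theorem kills_two {ω : V [⋀^Fin 2]→ₗ[F] F} {x : V} (h : ∀ y, ω ![x, y] = 0) : Kills ω x := by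
  intro v i hi
  fin_cases i
  · rw [← h (v 1)]; congr 1; ext j; fin_cases j <;> simp_all
  · rw [← neg_eq_zero, ← ω.map_swap v (show (0 : Fin 2) ≠ 1 by decide), ← h (v 0)]
    congr 1; ext j; fin_cases j <;> simp_all

theorem Kills.wpow {ω : V [⋀^Fin 2]→ₗ[F] F} {x : V} (h : Kills ω x) :
    ∀ k, Kills (wpow ω k) x
  | 0 => fun _ i => i.elim0
  | k + 1 => (h.wpow k).wedgeF h

theorem wedgeF_append {a b : ℕ} (α : V [⋀^Fin a]→ₗ[F] F) (β : V [⋀^Fin b]→ₗ[F] F)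
    (x : Fin a → V) (y : Fin b → V) (h : ∀ j, Kills α (y j)) :
    wedgeF α β (Fin.append x y) = α x * β y := by
  rw [wedgeF_apply]
  refine (Finset.sum_eq_single (Quotient.mk'' 1) ?_ ?_).trans ?_
  · intro σ _ hσ
    induction σ using Quotient.inductionOn' with | _ σ
    rw [mul'_summand_mk]
    by_cases hex : ∃ i j, σ (Sum.inl i) = Sum.inr j
    · obtain ⟨i, j, hij⟩ := hex
      rw [h j _ i, zero_mul, smul_zero]
      simp [hij]
    · refine absurd ?_ hσ
      refine Quotient.sound' ?_
      rw [QuotientGroup.leftRel_apply]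
      rw [mul_one, inv_mem_iff]
      apply Equiv.Perm.mem_sumCongrHom_range_of_perm_mapsTo_inl
      rintro _ ⟨i, rfl⟩
      rcases hi : σ (Sum.inl i) with k | k
      · exact ⟨k, rfl⟩
      · exact absurd ⟨i, k, hi⟩ hex
  · simp
  · rw [mul'_summand_mk]
    simp

theorem nsmul_wedgeF {a b : ℕ} (n p : ℕ) (α : V [⋀^Fin a]→ₗ[F] F) (β : V [⋀^Fin b]→ₗ[F] F) :
    wedgeF (n • α) (p • β) = (n * p) • wedgeF α β := by
  ext v
  rw [AlternatingMap.smul_apply, wedgeF_apply, wedgeF_apply, Finset.smul_sum]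
  refine Finset.sum_congr rfl fun σ _ => ?_
  induction σ using Quotient.inductionOn' with | _ σ
  rw [mul'_summand_mk, mul'_summand_mk, smul_comm (n * p)]
  simp only [AlternatingMap.smul_apply, nsmul_eq_mul, Nat.cast_mul]
  congr 1
  ring

theorem wpow_eq_zero {ι : Type} (b : Module.Basis ι F V) (s : Finset ι)
    (ω : V [⋀^Fin 2]→ₗ[F] F) (h : ∀ i ∉ s, ∀ y, ω ![b i, y] = 0) (k : ℕ)
    (hk : s.card < 2 * k) : wpow ω k = 0 := by
  refine b.ext_alternating fun v hv => ?_
  obtain ⟨i, hi⟩ : ∃ i, v i ∉ s := by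
    by_contra! hcon
    have := Finset.card_le_card_of_injOn (s := Finset.univ) (t := s) v
      (fun i _ => hcon i) hv.injOn
    simp at this
    omega
  exact (kills_two (h _ hi)).wpow k _ i rfl

end wedge

section pairing

variable {F V : Type} [CommRing F] [AddCommGroup V] [Module F V]

/-- The multilinear form `v ↦ ∏ᵢ ω(v₂ᵢ, v₂ᵢ₊₁)`. -/
def pairProd (ω : V [⋀^Fin 2]→ₗ[F] F) : (k : ℕ) → MultilinearMap F (fun _ : Fin (2 * k) => V) F
  | 0 => MultilinearMap.constOfIsEmpty F (fun _ : Fin 0 => V) 1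
  | k + 1 => MultilinearMap.domDomCongr (finSumFinEquiv (m := 2 * k) (n := 2))
      ((LinearMap.mul' F F).compMultilinearMap ((pairProd ω k).domCoprod ω.toMultilinearMap))

theorem pairProd_apply (ω : V [⋀^Fin 2]→ₗ[F] F) (k : ℕ) (v : Fin (2 * k) → V) :
    pairProd ω k v = ∏ i : Fin k, ω ![v ⟨2 * i, by omega⟩, v ⟨2 * i + 1, by omega⟩] := by
  induction k with
  | zero => simp [pairProd]
  | succ k ih =>
    rw [Fin.prod_univ_castSucc]
    have h : pairProd ω (k + 1) v = pairProd ω k (fun i => v (Fin.castAdd 2 i)) *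
        ω (fun i => v (Fin.natAdd (2 * k) i)) := by
      simp only [pairProd, MultilinearMap.domDomCongr_apply, LinearMap.compMultilinearMap_apply,
        MultilinearMap.domCoprod_apply, LinearMap.mul'_apply]
      rfl
    rw [h, ih]
    congr 2
    ext i
    fin_cases i <;> rfl

theorem two_pow_smul_wpow (ω : V [⋀^Fin 2]→ₗ[F] F) (k : ℕ) :
    2 ^ k • wpow ω k = MultilinearMap.alternatization (pairProd ω k) := by
  induction k with
  | zero =>
    have : IsEmpty (Fin (2 * 0)) := inferInstanceAs (IsEmpty (Fin 0))
    ext v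
    rw [MultilinearMap.alternatization_apply, Fintype.sum_subsingleton _ 1]
    simp only [pow_zero, one_smul, map_one, MultilinearMap.domDomCongr_apply]
    rfl
  | succ k ih =>
    have hω : MultilinearMap.alternatization (ω : MultilinearMap F (fun _ : Fin 2 => V) F) =
        2 • ω := by
      rw [AlternatingMap.coe_alternatization]; simp
    have hp : MultilinearMap.alternatization (pairProd ω (k + 1)) =
        wedgeF (MultilinearMap.alternatization (pairProd ω k)) (2 • ω) := by
      rw [← hω, wedgeF, ← MultilinearMap.domCoprod_alternization,
        ← LinearMap.compMultilinearMap_alternatization]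
      ext v
      simp only [AlternatingMap.domDomCongr_apply, MultilinearMap.alternatization_apply,
        MultilinearMap.domDomCongr_apply]
      refine (Fintype.sum_equiv (finSumFinEquiv (m := 2 * k) (n := 2)).permCongr _ _
        fun σ => ?_).symm
      refine congrArg₂ _ (Equiv.Perm.sign_permCongr _ _).symm ?_
      simp only [pairProd, MultilinearMap.domDomCongr_apply]
      congr 1
      ext i
      simp
    rw [hp, ← ih, nsmul_wedgeF, ← pow_succ]
    rfl

end pairing

section recursion

variable {F V : Type} [CommRing F] [AddCommGroup V] [Module F V]

theorem pairProd_comp_swap (ω : V [⋀^Fin 2]→ₗ[F] F) (k : ℕ) (w : Fin (2 * k + 1 + 1) → V) :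
    pairProd ω (k + 1) (w ∘ Equiv.swap 0 1) = -pairProd ω (k + 1) w := by
  rw [pairProd_apply, pairProd_apply, Fin.prod_univ_succ, Fin.prod_univ_succ, ← neg_mul]
  congr 1
  · rw [← ω.map_swap _ (show (0 : Fin 2) ≠ 1 by decide)]
    congr 1
    ext i
    fin_cases i
    · exact congrArg w (Equiv.swap_apply_left 0 1)
    · exact congrArg w (Equiv.swap_apply_right 0 1)

theorem exists_perm_pairProd (ω : V [⋀^Fin 2]→ₗ[F] F) (k : ℕ) (p : Fin (2 * k + 1 + 1)) :
    ∃ ρ : Equiv.Perm (Fin (2 * k + 1 + 1)), ρ 0 = p ∧ ∀ w : Fin (2 * k + 1 + 1) → V,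
      Equiv.Perm.sign ρ • pairProd ω (k + 1) (w ∘ ρ) = pairProd ω (k + 1) w := by
  have key : ∀ i : Fin (k + 1), ∃ ρ : Equiv.Perm (Fin (2 * k + 1 + 1)),
      (ρ 0).val = 2 * i.val ∧ (ρ 1).val = 2 * i.val + 1 ∧ Equiv.Perm.sign ρ = 1 ∧
        ∀ w : Fin (2 * k + 1 + 1) → V, pairProd ω (k + 1) (w ∘ ρ) = pairProd ω (k + 1) w := by
    intro i
    obtain ⟨P, hP⟩ : ∃ P : Fin (2 * k + 1 + 1), P.val = 2 * i.val := ⟨⟨2 * i.val, by omega⟩, rfl⟩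
    obtain ⟨Q, hQ⟩ : ∃ Q : Fin (2 * k + 1 + 1), Q.val = 2 * i.val + 1 :=
      ⟨⟨2 * i.val + 1, by omega⟩, rfl⟩
    have hval : ∀ t : Fin (2 * k + 1 + 1),
        ((Equiv.swap 0 P * Equiv.swap 1 Q : Equiv.Perm (Fin (2 * k + 1 + 1))) t).val =
          if t.val = 0 then 2 * i.val else if t.val = 1 then 2 * i.val + 1
          else if t.val = 2 * i.val then 0 else if t.val = 2 * i.val + 1 then 1 else t.val := by
      intro t
      rw [Equiv.Perm.mul_apply, Equiv.swap_apply_def, Equiv.swap_apply_def]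
      simp only [Fin.ext_iff, hP, hQ, apply_ite Fin.val, Fin.val_zero, Fin.val_one]
      split_ifs <;> first | contradiction | omega
    refine ⟨Equiv.swap 0 P * Equiv.swap 1 Q, by rw [hval]; simp, by rw [hval]; simp, ?_, ?_⟩
    · rw [Equiv.Perm.sign_mul]
      by_cases hi : i.val = 0
      · have h0 : P = 0 := Fin.ext (by simp [hP, hi])
        have h1 : Q = 1 := Fin.ext (by simp [hQ, hi])
        simp [h0, h1]
      · rw [Equiv.Perm.sign_swap, Equiv.Perm.sign_swap]
        · rfl
        · intro h; rw [Fin.ext_iff, hQ, Fin.val_one] at h; omega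
        · intro h; rw [Fin.ext_iff, hP, Fin.val_zero] at h; omega
    · intro w
      rw [pairProd_apply, pairProd_apply, ← Equiv.prod_comp (Equiv.swap 0 i)
        (fun j : Fin (k + 1) => ω ![w ⟨2 * j, by omega⟩, w ⟨2 * j + 1, by omega⟩])]
      refine Finset.prod_congr rfl fun j _ => ?_
      have hs : (Equiv.swap 0 i j).val = if j.val = 0 then i.val else if j.val = i.val then 0
          else j.val := by
        rw [Equiv.swap_apply_def]
        simp only [Fin.ext_iff, apply_ite Fin.val, Fin.val_zero]
      congr 1
      ext t
      fin_cases t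
      · refine congrArg w (Fin.ext ?_)
        rw [hval]
        simp only
        generalize (Equiv.swap 0 i j).val = s at hs ⊢
        split_ifs at hs ⊢ <;> first | contradiction | omega
      · refine congrArg w (Fin.ext ?_)
        rw [hval]
        simp only
        generalize (Equiv.swap 0 i j).val = s at hs ⊢
        split_ifs at hs ⊢ <;> first | contradiction | omega
  obtain ⟨ρ, h0, h1, hsign, h⟩ := key ⟨p.val / 2, by omega⟩
  rcases Nat.mod_two_eq_zero_or_one p.val with hp | hp
  · refine ⟨ρ, Fin.ext ?_, fun w => by rw [hsign, one_smul, h]⟩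
    rw [h0]; simp only; omega
  · refine ⟨ρ * Equiv.swap 0 1, Fin.ext ?_, fun w => ?_⟩
    · rw [Equiv.Perm.mul_apply, Equiv.swap_apply_left, h1]; simp only; omega
    · rw [Equiv.Perm.sign_mul, hsign, Equiv.Perm.sign_swap (by simp),
        Equiv.Perm.coe_mul, ← Function.comp_assoc, pairProd_comp_swap, h]
      simp

theorem alternatization_pairProd_succ (ω : V [⋀^Fin 2]→ₗ[F] F) (k : ℕ)
    (v : Fin (2 * k + 1 + 1) → V) :
    MultilinearMap.alternatization (pairProd ω (k + 1)) v = (2 * k + 2) •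
      ∑ τ : Equiv.Perm (Fin (2 * k + 1)),
        Equiv.Perm.sign τ • pairProd ω (k + 1) (v ∘ Equiv.Perm.decomposeFin.symm (0, τ)) := by
  set G : Equiv.Perm (Fin (2 * k + 1 + 1)) → F :=
    fun σ => Equiv.Perm.sign σ • pairProd ω (k + 1) (v ∘ σ) with hG
  have h1 : MultilinearMap.alternatization (pairProd ω (k + 1)) v = ∑ σ, G σ := by
    rw [MultilinearMap.alternatization_apply]
    rfl
  have h2 : ∀ p, ∑ σ, (if σ p = 0 then G σ else 0) = ∑ σ, if σ 0 = 0 then G σ else 0 := by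
    intro p
    obtain ⟨ρ, rfl, hρ⟩ := exists_perm_pairProd ω k p
    rw [← Equiv.sum_comp (Equiv.mulRight ρ) (fun σ => if σ 0 = 0 then G σ else 0)]
    refine Finset.sum_congr rfl fun σ _ => ?_
    simp only [Equiv.coe_mulRight, Equiv.Perm.mul_apply, hG]
    rw [Equiv.Perm.sign_mul, Equiv.Perm.coe_mul, ← Function.comp_assoc, mul_smul, hρ]
  have h3 : ∑ σ, G σ = ∑ p : Fin (2 * k + 1 + 1), ∑ σ, (if σ p = 0 then G σ else 0) := by
    rw [Finset.sum_comm]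
    refine Finset.sum_congr rfl fun σ _ => ?_
    rw [Finset.sum_eq_single (σ⁻¹ 0)]
    · simp
    · intro p _ hp
      rw [if_neg]
      rintro h
      exact hp (by simp [← h])
    · simp
  rw [h1, h3, Finset.sum_congr rfl fun p _ => h2 p, Finset.sum_const, Finset.card_univ,
    Fintype.card_fin]
  congr 1
  rw [← Equiv.sum_comp Equiv.Perm.decomposeFin.symm, Fintype.sum_prod_type,
    Finset.sum_eq_single 0]
  · refine Finset.sum_congr rfl fun τ _ => ?_
    simp [hG]
  · intro p _ hp
    refine Finset.sum_eq_zero fun τ _ => ?_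
    simp [hp]
  · simp

theorem pairProd_cons (ω : V [⋀^Fin 2]→ₗ[F] F) (k : ℕ) (x y : V) (v : Fin (2 * k) → V) :
    pairProd ω (k + 1) (Fin.cons x (Fin.cons y v : Fin (2 * k + 1) → V) :
      Fin (2 * k + 1 + 1) → V) = ω ![x, y] * pairProd ω k v := by
  rw [pairProd_apply, pairProd_apply, Fin.prod_univ_succ]
  rfl

theorem alternatization_pairProd_cons (ω : V [⋀^Fin 2]→ₗ[F] F) (k : ℕ) (x y : V)
    (v : Fin (2 * k) → V) :
    MultilinearMap.alternatization (pairProd ω (k + 1))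
      (Fin.cons x (Fin.cons y v : Fin (2 * k + 1) → V) : Fin (2 * k + 1 + 1) → V) =
    (2 * k + 2) • (ω ![x, y] * MultilinearMap.alternatization (pairProd ω k) v -
      ∑ i, ω ![x, v i] *
        MultilinearMap.alternatization (pairProd ω k) (Function.update v i y)) := by
  rw [alternatization_pairProd_succ]
  congr 1
  have hu : ∀ i : Fin (2 * k), (Fin.cons y v : Fin (2 * k + 1) → V) ∘ Equiv.swap 0 i.succ ∘
      Fin.succ = Function.update v i y := by
    intro i
    ext j
    by_cases h : j = i
    · subst h; simp
    · rw [Function.update_of_ne h]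
      simp only [Function.comp_apply]
      rw [Equiv.swap_apply_of_ne_of_ne (Fin.succ_ne_zero j) (by simpa using h), Fin.cons_succ]
  rw [← Equiv.sum_comp Equiv.Perm.decomposeFin.symm, Fintype.sum_prod_type,
    Fin.sum_univ_succ, sub_eq_add_neg, ← Finset.sum_neg_distrib]
  have hcomp : ∀ (j : Fin (2 * k + 1)) (ρ : Equiv.Perm (Fin (2 * k))),
      (Fin.cons x (Fin.cons y v : Fin (2 * k + 1) → V) : Fin (2 * k + 1 + 1) → V) ∘
        Equiv.Perm.decomposeFin.symm (0, Equiv.Perm.decomposeFin.symm (j, ρ)) =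
      Fin.cons x (Fin.cons ((Fin.cons y v : Fin (2 * k + 1) → V) j)
        (((Fin.cons y v : Fin (2 * k + 1) → V) ∘ Equiv.swap 0 j ∘ Fin.succ) ∘ ρ) :
          Fin (2 * k + 1) → V) := by
    intro j ρ
    ext t
    refine Fin.cases ?_ (fun t => ?_) t
    · simp
    · refine Fin.cases ?_ (fun t => ?_) t <;> simp
  simp only [hcomp, pairProd_cons, MultilinearMap.alternatization_apply,
    MultilinearMap.domDomCongr_apply, Finset.mul_sum, ← Finset.sum_neg_distrib, hu]
  congr 1
  · refine Finset.sum_congr rfl fun ρ _ => ?_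
    simp [Function.comp_def, mul_smul_comm]
  · refine Finset.sum_congr rfl fun i _ => Finset.sum_congr rfl fun ρ _ => ?_
    simp [Function.comp_def, mul_smul_comm]

end recursion

section descent

variable {F V : Type} [CommRing F] [Algebra ℝ F] [AddCommGroup V] [Module F V]

theorem isUnit_natCast {n : ℕ} (hn : n ≠ 0) : IsUnit (n : F) := by
  have h : IsUnit (n : ℝ) := isUnit_iff_ne_zero.2 (Nat.cast_ne_zero.2 hn)
  simpa using h.map (algebraMap ℝ F)

theorem wpow_cons (ω : V [⋀^Fin 2]→ₗ[F] F) (k : ℕ) (x y : V) (v : Fin (2 * k) → V) :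
    wpow ω (k + 1)
      (Fin.cons x (Fin.cons y v : Fin (2 * k + 1) → V) : Fin (2 * k + 1 + 1) → V) =
    ((k + 1 : ℕ) : F) * (ω ![x, y] * wpow ω k v -
      ∑ i, ω ![x, v i] * wpow ω k (Function.update v i y)) := by
  have h := alternatization_pairProd_cons ω k x y v
  rw [← two_pow_smul_wpow, ← two_pow_smul_wpow] at h
  simp only [AlternatingMap.smul_apply, nsmul_eq_mul] at h
  have hu : IsUnit (((2 ^ (k + 1) : ℕ)) : F) := isUnit_natCast (by positivity)
  refine hu.mul_left_cancel (h.trans ?_)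
  have hs : ∀ g : Fin (2 * k) → F, ∑ i, ω ![x, v i] * (((2 ^ k : ℕ) : F) * g i) =
      ((2 ^ k : ℕ) : F) * ∑ i, ω ![x, v i] * g i := by
    intro g
    rw [Finset.mul_sum]
    exact Finset.sum_congr rfl fun i _ => by ring
  rw [hs]
  push_cast
  ring

/-- If `(e, f)` are dual families for `ω` on `U` of trace `N`, contracting `ωᵏ⁺¹` with them
gives a nonzero multiple of `ωᵏ` on `U` as long as `2k < N`. -/
theorem wpow_mul_mem_of_succ {ι : Type} (s : Finset ι) (ω : V [⋀^Fin 2]→ₗ[F] F) (U : Set V)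
    (e f : ι → V) (he : ∀ j ∈ s, e j ∈ U) (hf : ∀ j ∈ s, f j ∈ U)
    (hdual : ∀ v ∈ U, ∑ j ∈ s, ω ![f j, v] • e j = v) (N : ℕ)
    (htr : ∑ j ∈ s, ω ![f j, e j] = N) (I : Ideal F) (t : F) (k : ℕ) (hk : 2 * k < N)
    (H : ∀ v : Fin (2 * (k + 1)) → V, (∀ i, v i ∈ U) → wpow ω (k + 1) v * t ∈ I)
    (v : Fin (2 * k) → V) (hv : ∀ i, v i ∈ U) : wpow ω k v * t ∈ I := by
  have hsum : ∑ j ∈ s, wpow ω (k + 1)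
      (Fin.cons (f j) (Fin.cons (e j) v : Fin (2 * k + 1) → V) : Fin (2 * k + 1 + 1) → V) =
      (((k + 1) * (N - 2 * k) : ℕ) : F) * wpow ω k v := by
    have hi : ∀ i, ∑ j ∈ s, ω ![f j, v i] * wpow ω k (Function.update v i (e j)) =
        wpow ω k v := by
      intro i
      conv_rhs => rw [← Function.update_eq_self i v, ← hdual (v i) (hv i)]
      rw [AlternatingMap.map_update_sum]
      simp only [AlternatingMap.map_update_smul, smul_eq_mul]
    simp only [wpow_cons]
    rw [← Finset.mul_sum, Finset.sum_sub_distrib, ← Finset.sum_mul, htr, Finset.sum_comm,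
      Finset.sum_congr rfl fun i _ => hi i, Finset.sum_const, Finset.card_univ,
      Fintype.card_fin, nsmul_eq_mul, Nat.cast_mul (k + 1), Nat.cast_sub hk.le]
    ring
  have hu : IsUnit (((k + 1) * (N - 2 * k) : ℕ) : F) :=
    isUnit_natCast (Nat.mul_ne_zero (by omega) (by omega))
  rw [← Ideal.unit_mul_mem_iff_mem I hu, ← mul_assoc, ← hsum, Finset.sum_mul]
  refine I.sum_mem fun j hj => H _ fun i => ?_
  refine Fin.cases ?_ (fun i => ?_) (i : Fin (2 * k + 1 + 1))
  · exact hf j hj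
  · refine Fin.cases ?_ (fun i => ?_) i
    · exact he j hj
    · exact hv i

theorem mem_of_wpow_mul_mem {ι : Type} (s : Finset ι) (ω : V [⋀^Fin 2]→ₗ[F] F) (U : Set V)
    (e f : ι → V) (he : ∀ j ∈ s, e j ∈ U) (hf : ∀ j ∈ s, f j ∈ U)
    (hdual : ∀ v ∈ U, ∑ j ∈ s, ω ![f j, v] • e j = v) (N : ℕ)
    (htr : ∑ j ∈ s, ω ![f j, e j] = N) (I : Ideal F) (t : F) (k : ℕ) (hk : 2 * k ≤ N)
    (H : ∀ v : Fin (2 * k) → V, (∀ i, v i ∈ U) → wpow ω k v * t ∈ I) : t ∈ I := by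
  induction k with
  | zero => simpa [wpow] using H (fun i => i.elim0) (fun i => i.elim0)
  | succ k ih =>
    exact ih (by omega)
      (wpow_mul_mem_of_succ s ω U e f he hf hdual N htr I t k (by omega) H)

end descent

section frame

variable {F V : Type} [CommRing F] [Algebra ℝ F] [AddCommGroup V] [Module F V]
  [SmoothSetting F V] [ACM3 F V]

theorem gm_fr (i j : Fin (4 * dimn F V + 3)) :
    gm F V (fr F V i) (fr F V j) = if i = j then 1 else 0 := ACM3.frame_orth i j

theorem sum_gm_fr (X : V) : ∑ i, gm F V X (fr F V i) • fr F V i = X := (ACM3.frame_span X).symm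

variable (F V) in
/-- The orthonormal frame as a basis. -/
def frBasis : Module.Basis (Fin (4 * dimn F V + 3)) F V :=
  Module.Basis.mk (v := fr F V)
    (by
      rw [Fintype.linearIndependent_iff]
      intro f hf i
      have h := congrArg (gmL F V (fr F V i)) hf
      simpa [map_sum, gmL_apply, gm_smul_right, gm_fr, gm_zero_right] using h)
    (by
      intro X _
      rw [← sum_gm_fr (F := F) X]
      exact Submodule.sum_mem _ fun i _ =>
        Submodule.smul_mem _ _ (Submodule.subset_span (Set.mem_range_self i)))

theorem frBasis_apply (i : Fin (4 * dimn F V + 3)) : frBasis F V i = fr F V i :=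
  Module.Basis.mk_apply _ _ i

theorem sum_gm_fr_of_subset (s : Finset (Fin (4 * dimn F V + 3))) (X : V)
    (h : ∀ i ∉ s, gm F V (fr F V i) X = 0) :
    ∑ i ∈ s, gm F V (fr F V i) X • fr F V i = X := by
  conv_rhs => rw [← sum_gm_fr (F := F) X]
  rw [← Finset.sum_subset s.subset_univ fun i _ hi => by rw [gm_symm, h i hi, zero_smul]]
  exact Finset.sum_congr rfl fun i _ => by rw [gm_symm]

theorem et_rxi (a b : Fin 3) : et F V a (rxi F V b) = if a = b then 1 else 0 := by
  obtain ⟨c, d, h⟩ := exists_cyclic a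
  revert b
  refine (h.forall_iff _).2 ⟨?_, ?_, ?_⟩
  · simp [et_xi_self]
  · rw [et_xi_next h, if_neg]
    rcases h with h | h | h <;> simp_all
  · rw [et_xi_prev h.rotate.rotate, if_neg]
    rcases h with h | h | h <;> simp_all

theorem gm_rxi_of_InE4m {W : V} (hW : InE4m F V W) (a : Fin 3) :
    gm F V (rxi F V a) W = 0 := by
  rw [gm_symm, ← et_eq_gm, hW.1 a]

variable (F V) in
/-- Indices of the frame vectors in `E^{4m}`. -/
def idxE4m (l : ℕ) : Finset (Fin (4 * dimn F V + 3)) :=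
  (Finset.Ico (4 * l) (4 * dimn F V)).attachFin fun _ hi => by
    have := (Finset.mem_Ico.1 hi).2
    omega

variable (F V) in
/-- Indices of the frame vectors orthogonal to `E^{4m} ⊕ ⟨ξ_β⟩`. -/
def idxContact (l : ℕ) (β : Fin 3) : Finset (Fin (4 * dimn F V + 3)) :=
  ((Finset.range (4 * dimn F V + 3) \ Finset.Ico (4 * l) (4 * dimn F V)).erase
    (4 * dimn F V + β.val)).attachFin fun _ hi =>
      Finset.mem_range.1 (Finset.mem_sdiff.1 (Finset.mem_of_mem_erase hi)).1

theorem mem_idxE4m {l : ℕ} {i : Fin (4 * dimn F V + 3)} :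
    i ∈ idxE4m F V l ↔ 4 * l ≤ i.val ∧ i.val < 4 * dimn F V := by
  simp [idxE4m]

theorem mem_idxContact {l : ℕ} {β : Fin 3} {i : Fin (4 * dimn F V + 3)} :
    i ∈ idxContact F V l β ↔
      i.val ≠ 4 * dimn F V + β.val ∧ (4 * l ≤ i.val → 4 * dimn F V ≤ i.val) := by
  simp [idxContact]

theorem card_idxE4m {l m : ℕ} (hm : dimn F V = l + m) : (idxE4m F V l).card = 4 * m := by
  rw [idxE4m, Finset.card_attachFin, Nat.card_Ico]
  omega

theorem card_idxContact {l m : ℕ} (hm : dimn F V = l + m) (β : Fin 3) :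
    (idxContact F V l β).card = 2 * (2 * l + 1) := by
  rw [idxContact, Finset.card_attachFin, Finset.card_erase_of_mem, Finset.card_sdiff_of_subset,
    Nat.card_Ico, Finset.card_range]
  · omega
  · intro i hi
    simp only [Finset.mem_Ico, Finset.mem_range] at hi ⊢
    omega
  · simp

theorem notMem_idxE4m {β : Fin 3} {i : Fin (4 * dimn F V + 3)} (hi : i ∈ idxContact F V l β) :
    i ∉ idxE4m F V l := by
  rw [mem_idxE4m]
  rw [mem_idxContact] at hi
  omega

end frame

section volume

variable {F V : Type} [CommRing F] [Algebra ℝ F] [AddCommGroup V] [Module F V]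
  [SmoothSetting F V] [ACM3 F V] [ThreeQS F V]

theorem psiT_of_orthogonal (hc : cc F V ≠ 0) (a : Fin 3) {X : V}
    (hX : ∀ W, InE4m F V W → gm F V X W = 0) : psiT F V a X = ph F V a X := by
  obtain ⟨Y, Z, hY, hZ, h⟩ := exists_decomposition (F := F) X
  have hZ0 : Z = 0 := by
    refine ACM3.g_nondeg (F := F) Z fun W => ?_
    obtain ⟨Y', Z', hY', hZ', h'⟩ := exists_decomposition (F := F) W
    have h1 := hX Z' hZ'
    rw [h, gm_add_left, gm_add_left, hY.2 Z' hZ', gm_symm _ Z', gm_symm _ Z',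
      gm_sum_xi_of_horiz hZ'.1] at h1
    change gm F V Z W = 0
    rw [h', gm_add_right, gm_add_right, gm_sum_xi_of_horiz hZ.1, gm_symm Z Y', hY'.2 Z hZ,
      gm_symm Z Z']
    linear_combination h1
  rw [h, hZ0]
  simp only [Fin.sum_univ_three, psiT_add, psiT_smul, ph_add, ph_smul, psiT_E4l a hY,
    psiT_xi hc, ph_zero, psiT_E4m a (hZ0 ▸ hZ)]

theorem thetaT_of_orthogonal (hc : cc F V ≠ 0) (a : Fin 3) {X : V}
    (hX : ∀ W, InE4m F V W → gm F V X W = 0) : thetaT F V a X = 0 := by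
  rw [thetaT, psiT_of_orthogonal hc a hX, sub_self]

theorem dOne_et_eq (hc : cc F V ≠ 0) (a : Fin 3) (X Y : V) :
    dOne F V (et F V a) X Y = algebraMap ℝ F (cc F V / 2) * gm F V X (psiT F V a Y) := by
  rw [dOne_eq, dTwice_eq_psi hc, Algebra.smul_def, ← mul_assoc, ← map_mul, div_eq_inv_mul]

section rank

variable {l : ℕ} [HasRank F V l]

theorem fr_InE4m {i : Fin (4 * dimn F V + 3)} (hi : i ∈ idxE4m F V l) : InE4m F V (fr F V i) :=
  HasRank.frame_E4m i (mem_idxE4m.1 hi).1 (mem_idxE4m.1 hi).2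

variable (l) in
theorem InE4l_or_xi (i : Fin (4 * dimn F V + 3)) (hi : i ∉ idxE4m F V l) :
    InE4l F V (fr F V i) ∨ ∃ a : Fin 3, i.val = 4 * dimn F V + a.val ∧
      fr F V i = rxi F V a := by
  rw [mem_idxE4m, not_and, not_lt] at hi
  by_cases h : i.val < 4 * l
  · exact Or.inl (HasRank.frame_E4l i h)
  · have hi' := hi (not_lt.1 h)
    have hv : i.val = 4 * dimn F V + (⟨i.val - 4 * dimn F V, by omega⟩ : Fin 3).val := by
      simp only
      omega
    exact Or.inr ⟨_, hv, HasRank.frame_xi l i _ hv⟩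

theorem fr_orthogonal_of_notMem {i : Fin (4 * dimn F V + 3)} (hi : i ∉ idxE4m F V l) {W : V}
    (hW : InE4m F V W) : gm F V (fr F V i) W = 0 := by
  rcases InE4l_or_xi l i hi with h | ⟨a, -, h⟩
  · exact h.2 W hW
  · rw [h, gm_rxi_of_InE4m hW]

theorem InE4m_or_xi_of_notMem {β : Fin 3} {i : Fin (4 * dimn F V + 3)}
    (hi : i ∉ idxContact F V l β) : InE4m F V (fr F V i) ∨ fr F V i = rxi F V β := by
  by_cases h : i.val = 4 * dimn F V + β.val
  · exact Or.inr (HasRank.frame_xi l i β h)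
  · refine Or.inl (fr_InE4m (l := l) (mem_idxE4m.2 ?_))
    rw [mem_idxContact] at hi
    push Not at hi
    exact hi h

theorem et_fr_of_mem {β : Fin 3} {i : Fin (4 * dimn F V + 3)} (hi : i ∈ idxContact F V l β) :
    et F V β (fr F V i) = 0 := by
  rcases InE4l_or_xi l i (notMem_idxE4m hi) with h | ⟨a, ha, h⟩
  · exact h.1 β
  · rw [h, et_rxi, if_neg]
    rintro rfl
    exact (mem_idxContact.1 hi).1 ha

end rank

section forms

variable (l m : ℕ) [HasRank F V l]

theorem mem_of_wpow_theta_mul_mem (hm : dimn F V = l + m) (γ : Fin 3) (Th : V [⋀^Fin 2]→ₗ[F] F)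
    (hTh : ∀ X Y : V, Th ![X, Y] = ThetaForm F V γ X Y) (I : Ideal F) (t : F)
    (H : ∀ v : Fin (2 * (2 * m)) → V, (∀ i, InE4m F V (v i)) → wpow Th (2 * m) v * t ∈ I) :
    t ∈ I := by
  have hval : ∀ X Y, InE4m F V Y → Th ![ph F V γ X, Y] = gm F V X Y := by
    intro X Y hY
    rw [hTh, ThetaForm, thetaT, psiT_E4m γ hY, sub_zero, gm_ph_ph, hY.1 γ, mul_zero, sub_zero]
  refine mem_of_wpow_mul_mem (idxE4m F V l) Th {X | InE4m F V X} (fr F V)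
    (fun i => ph F V γ (fr F V i)) (fun j hj => fr_InE4m hj)
    (fun j hj => ThreeQS.phi_E4m γ _ (fr_InE4m hj)) ?_ (4 * m) ?_ I t (2 * m) (by omega) H
  · intro v hv
    simp only [hval _ v hv]
    exact sum_gm_fr_of_subset _ v fun i hi => fr_orthogonal_of_notMem hi hv
  · rw [← card_idxE4m hm, Finset.card_eq_sum_ones, Nat.cast_sum]
    refine Finset.sum_congr rfl fun j hj => ?_
    rw [hval _ _ (fr_InE4m hj), gm_fr, if_pos rfl, Nat.cast_one]

theorem mem_of_wpow_dOne_mul_mem (hm : dimn F V = l + m) (β : Fin 3) (de : V [⋀^Fin 2]→ₗ[F] F)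
    (hde : ∀ X Y : V, de ![X, Y] = dOne F V (et F V β) X Y) (I : Ideal F) (t : F)
    (H : ∀ v : Fin (2 * (2 * l + 1)) → V,
      (∀ i, (∀ W, InE4m F V W → gm F V (v i) W = 0) ∧ et F V β (v i) = 0) →
        wpow de (2 * l + 1) v * t ∈ I) :
    t ∈ I := by
  have hc : cc F V ≠ 0 := HasRank.c_ne l
  set r : F := algebraMap ℝ F (2 / cc F V) with hr
  have hval : ∀ X Y, (∀ W, InE4m F V W → gm F V Y W = 0) → et F V β Y = 0 →
      de ![r • ph F V β X, Y] = gm F V X Y := by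
    intro X Y hY hY'
    rw [hde, dOne_et_eq hc, psiT_of_orthogonal hc β hY, gm_smul_left, gm_ph_ph, hY', ← mul_assoc,
      hr, ← map_mul, div_mul_div_cancel₀ two_ne_zero, div_self hc, map_one]
    ring
  have horth : ∀ j ∈ idxContact F V l β, ∀ W, InE4m F V W → gm F V (fr F V j) W = 0 :=
    fun j hj W hW => fr_orthogonal_of_notMem (notMem_idxE4m hj) hW
  refine mem_of_wpow_mul_mem (idxContact F V l β) de
    {X | (∀ W, InE4m F V W → gm F V X W = 0) ∧ et F V β X = 0} (fr F V)
    (fun i => r • ph F V β (fr F V i)) (fun j hj => ⟨horth j hj, et_fr_of_mem hj⟩)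
    (fun j hj => ⟨fun W hW => ?_, ?_⟩) ?_ (2 * (2 * l + 1)) ?_ I t (2 * l + 1) le_rfl H
  · rw [gm_smul_left, gm_ph_left, horth j hj _ (ThreeQS.phi_E4m β W hW), neg_zero, mul_zero]
  · rw [et_smul, et_ph_self, mul_zero]
  · rintro v ⟨hv, hv'⟩
    simp only [hval _ v hv hv']
    refine sum_gm_fr_of_subset _ v fun i hi => ?_
    rcases InE4m_or_xi_of_notMem hi with h | h
    · rw [gm_symm, hv _ h]
    · rw [h, gm_symm, ← et_eq_gm, hv']
  · rw [← card_idxContact hm β, Finset.card_eq_sum_ones, Nat.cast_sum]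
    refine Finset.sum_congr rfl fun j hj => ?_
    rw [hval _ _ (horth j hj) (et_fr_of_mem hj), gm_fr, if_pos rfl, Nat.cast_one]

theorem wpow_theta_eq_zero (hm : dimn F V = l + m) (γ : Fin 3) (Th : V [⋀^Fin 2]→ₗ[F] F)
    (hTh : ∀ X Y : V, Th ![X, Y] = ThetaForm F V γ X Y) : wpow Th (2 * m + 1) = 0 := by
  refine wpow_eq_zero (frBasis F V) (idxE4m F V l) Th (fun i hi Y => ?_) _ ?_
  · rw [frBasis_apply, hTh, ThetaForm_eq (HasRank.c_ne l), Phi_skew, dTwice_et_skew,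
      mul_neg, ← neg_sub', ← ThetaForm_eq (HasRank.c_ne l), ThetaForm,
      thetaT_of_orthogonal (HasRank.c_ne l) γ fun W hW => fr_orthogonal_of_notMem hi hW,
      gm_zero_right, neg_zero]
  · rw [card_idxE4m hm]
    omega

theorem wpow_dOne_eq_zero (hm : dimn F V = l + m) (β : Fin 3) (de : V [⋀^Fin 2]→ₗ[F] F)
    (hde : ∀ X Y : V, de ![X, Y] = dOne F V (et F V β) X Y) : wpow de (2 * l + 1 + 1) = 0 := by
  refine wpow_eq_zero (frBasis F V) (idxContact F V l β) de (fun i hi Y => ?_) _ ?_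
  · rw [frBasis_apply, hde]
    rcases InE4m_or_xi_of_notMem hi with h | h
    · exact h.2 β Y
    · rw [h, dOne_eq, dTwice_et_xi_self, smul_zero]
  · rw [card_idxContact hm β]
    omega

theorem isUnit_volume (hm : dimn F V = l + m) (β γ : Fin 3)
    (e : V [⋀^Fin 1]→ₗ[F] F) (he : ∀ X : V, e ![X] = et F V β X)
    (de : V [⋀^Fin 2]→ₗ[F] F) (hde : ∀ X Y : V, de ![X, Y] = dOne F V (et F V β) X Y)
    (Th : V [⋀^Fin 2]→ₗ[F] F) (hTh : ∀ X Y : V, Th ![X, Y] = ThetaForm F V γ X Y)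
    (h : 1 + (2 * (2 * l + 1) + 2 * (2 * m)) = 4 * dimn F V + 3) :
    IsUnit ((wedgeF e (wedgeF (wpow de (2 * l + 1)) (wpow Th (2 * m))))
      (fun i => fr F V (Fin.cast h i))) := by
  set T := wedgeF e (wedgeF (wpow de (2 * l + 1)) (wpow Th (2 * m)))
  set I : Ideal F := Ideal.span {T fun i => fr F V (Fin.cast h i)} with hI
  have hmem : ∀ v, T v ∈ I := by
    intro v
    have hb : ((frBasis F V).reindex (finCongr h.symm) : _ → V) =
        fun i => fr F V (Fin.cast h i) := by
      ext i
      simp [frBasis_apply]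
    rw [T.eq_smul_basis_det ((frBasis F V).reindex (finCongr h.symm)), hb,
      AlternatingMap.smul_apply, smul_eq_mul]
    exact I.mul_mem_right _ (Ideal.mem_span_singleton_self _)
  have heK : ∀ X, et F V β X = 0 → Kills e X := by
    intro X hX v i hi
    rw [← hX, ← he, ← hi, Subsingleton.elim i 0]
    congr 1
    ext j
    rw [Subsingleton.elim j 0]
    rfl
  rw [← Ideal.span_singleton_eq_top, ← hI, Ideal.eq_top_iff_one]
  refine mem_of_wpow_theta_mul_mem l m hm γ Th hTh I 1 fun y hy => ?_
  rw [mul_one]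
  refine mem_of_wpow_dOne_mul_mem l m hm β de hde I _ fun x hx => ?_
  have hT := hmem (Fin.append ![rxi F V β] (Fin.append x y))
  rw [wedgeF_append, he, et_xi_self, one_mul, wedgeF_append] at hT
  · exact hT
  · exact fun j => (kills_two fun Y => by rw [hde]; exact (hy j).2 β Y).wpow _
  · intro j
    refine Fin.addCases (fun j => ?_) (fun j => ?_) j
    · rw [Fin.append_left]
      exact heK _ (hx j).2
    · rw [Fin.append_right]
      exact heK _ ((hy j).1 β)

end forms

end volume

/-- On a 3-quasi-Sasakian manifold of rank `4l+3` (dimension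
`4n+3`, `m = n - l`), for each `β, γ ∈ {1,2,3}` the pair `(η_β, Θ_γ)` —
where `Θ_γ(X,Y) = g(X, θ_γ Y)` is the closed 2-form obtained by restricting
`Φ_γ` to `E^{4m}` (extended by zero on `E^{4l+3}`) — is a
contact-symplectic pair of type `(2l+1, 2m)`: `Θ_γ` is closed,
`η_β ∧ (dη_β)^{2l+1} ∧ Θ_γ^{2m}` is a volume form (nowhere vanishing,
i.e. invertible on the frame), `(dη_β)^{2l+2} = 0` and `Θ_γ^{2m+1} = 0`.
Here `e`, `de`, `Th` are the 1-form `η_β`, the 2-form `dη_β` and the 2-form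
`Θ_γ` regarded as alternating forms. -/
theorem contact_symplectic_pairs (F V : Type) [CommRing F] [Algebra ℝ F] [AddCommGroup V] [Module F V]
    [SmoothSetting F V] [ACM3 F V] [ThreeQS F V]
    (l m : ℕ) [HasRank F V l] (hm : dimn F V = l + m) (β γ : Fin 3)
    (e : V [⋀^Fin 1]→ₗ[F] F) (he : ∀ X : V, e ![X] = et F V β X)
    (de : V [⋀^Fin 2]→ₗ[F] F)
    (hde : ∀ X Y : V, de ![X, Y] = dOne F V (et F V β) X Y)
    (Th : V [⋀^Fin 2]→ₗ[F] F)
    (hTh : ∀ X Y : V, Th ![X, Y] = ThetaForm F V γ X Y) :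
    IsClosedTwo F V (ThetaForm F V γ) ∧
    IsUnit ((wedgeF e (wedgeF (wpow de (2 * l + 1)) (wpow Th (2 * m))))
      (fun i => fr F V (Fin.cast (by omega) i))) ∧
    wpow de (2 * l + 1 + 1) = 0 ∧
    wpow Th (2 * m + 1) = 0 := by
  have hc : cc F V ≠ 0 := HasRank.c_ne l
  exact ⟨ThetaForm_closed hc γ, isUnit_volume l m hm β γ e he de hde Th hTh (by omega),
    wpow_dOne_eq_zero l m hm β de hde, wpow_theta_eq_zero l m hm γ Th hTh⟩

end QS3
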